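/- arXiv:math/9906118 — 2 statements merged into one kernel-verified Lean document; each statement's English description precedes it below -/
import Mathlib

section
/- Let q ∈ L¹((0,∞);ℝ) be continuously differentiable on [0,∞). Then the function A(α,x) is jointly continuously differentiable on {(α,x) : α > 0, x ≥ 0} and satisfies there the equation ∂A(α,x)/∂x = ∂A(α,x)/∂α + ∫₀^α A(β,x) A(α−β,x) dβ. -/
open MeasureTheory Set Filter
open scoped ENNReal

noncomputable section

/-- `Q(α) = ∫₀^α |q(y)| dy`. -/
def Qfun (q : ℝ → ℝ) (α : ℝ) : ℝ := ∫ y in Ioc (0:ℝ) α, |q y|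

/-- The region `R_n(α)` for `n = k + 2`, as a subset of
`ℝ^{2n-2} = (Fin n → ℝ) × (Fin (n-2) → ℝ)`. -/
def Rregion (k : ℕ) (α : ℝ) : Set ((Fin (k+2) → ℝ) × (Fin k → ℝ)) :=
  {p | (∀ i, 0 ≤ p.1 i) ∧
    (∀ i : Fin k,
      |p.1 (Fin.castLE (by omega) i) - p.1 (Fin.castLE (by omega) i.succ)| ≤ p.2 i ∧
      p.2 i ≤ p.1 (Fin.castLE (by omega) i) + p.1 (Fin.castLE (by omega) i.succ)) ∧
    |p.1 ⟨k, by omega⟩ - p.1 ⟨k+1, by omega⟩| ≤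
        2*α - p.1 ⟨0, by omega⟩ - p.1 ⟨k+1, by omega⟩ - ∑ j, p.2 j ∧
      2*α - p.1 ⟨0, by omega⟩ - p.1 ⟨k+1, by omega⟩ - ∑ j, p.2 j ≤
        p.1 ⟨k, by omega⟩ + p.1 ⟨k+1, by omega⟩}

/-- `A_n(α; q)`, defined for `n ≥ 2` (for `n < 2` the value is irrelevant). -/
def An (q : ℝ → ℝ) (n : ℕ) (α : ℝ) : ℝ :=
  ((-1 : ℝ)^(n-1) / 2^(n-2)) * ∫ p in Rregion (n-2) α, ∏ i, q (p.1 i)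

/-- The `A`-function of `q`:  `A(α) = q(α) + ∑_{n=2}^∞ A_n(α)`. -/
def Afun (q : ℝ → ℝ) (α : ℝ) : ℝ := q α + ∑' k : ℕ, An q (k+2) α

/-- `A(α,x)`:  the `A`-function of the translated potential `y ↦ q(x+y)`. -/
def Axfun (q : ℝ → ℝ) (α x : ℝ) : ℝ := Afun (fun y => q (x + y)) α

/-! ### Zigzag integrals -/

/-- Leibniz rule for an integral with parameter in the integrand and in the upper limit. -/
lemma hasDerivAt_integral_upper {f f' : ℝ → ℝ → ℝ} (hf : Continuous ↿f) (hf' : Continuous ↿f')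
    (hd : ∀ v b, HasDerivAt (fun s => f s b) (f' v b) v) {u : ℝ → ℝ} {u' s₀ : ℝ}
    (hu : HasDerivAt u u' s₀) :
    HasDerivAt (fun s => ∫ b in (0:ℝ)..u s, f s b)
      (u' * f s₀ (u s₀) + ∫ b in (0:ℝ)..u s₀, f' s₀ b) s₀ := by
  have hcf : ∀ v, Continuous (f v) := fun v => hf.comp (by fun_prop : Continuous fun b => (v, b))
  have hcf' : ∀ v, Continuous (f' v) :=
    fun v => hf'.comp (by fun_prop : Continuous fun b => (v, b))
  have hpar : ∀ v e : ℝ, HasDerivAt (fun s => ∫ b in (0:ℝ)..e, f s b)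
      (∫ b in (0:ℝ)..e, f' v b) v := by
    intro v e
    obtain ⟨M, hM⟩ := ((isCompact_Icc (a := v - 1) (b := v + 1)).prod
      (isCompact_uIcc (a := (0:ℝ)) (b := e))).exists_bound_of_continuousOn hf'.continuousOn
    refine (intervalIntegral.hasDerivAt_integral_of_dominated_loc_of_deriv_le
      (F := f) (F' := f') (bound := fun _ => M)
      (Icc_mem_nhds (by linarith : v - 1 < v) (by linarith : v < v + 1))
      (Eventually.of_forall fun s => (hcf s).aestronglyMeasurable)
      ((hcf v).intervalIntegrable _ _) (hcf' v).aestronglyMeasurable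
      (Eventually.of_forall fun b hb s hs => ?_) (by simp)
      (Eventually.of_forall fun b _ s _ => hd s b)).2
    exact hM (s, b) ⟨hs, uIoc_subset_uIcc hb⟩
  have hprim : ∀ v e : ℝ, HasDerivAt (fun e => ∫ b in (0:ℝ)..e, f v b) (f v e) e := fun v e =>
    intervalIntegral.integral_hasDerivAt_right ((hcf v).intervalIntegrable _ _)
      ((hcf v).stronglyMeasurableAtFilter _ _) (hcf v).continuousAt
  have hpc : Continuous fun p : ℝ × ℝ => ∫ b in (0:ℝ)..p.2, f' p.1 b :=
    intervalIntegral.continuous_parametric_intervalIntegral_of_continuous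
      (f := fun (p : ℝ × ℝ) b => f' p.1 b)
      (hf'.comp (by fun_prop : Continuous fun z : (ℝ × ℝ) × ℝ => (z.1.1, z.2))) (by fun_prop)
  have hF := (hasStrictFDerivAt_uncurry_coprod (𝕜 := ℝ) (u := (s₀, u s₀))
    (f := fun v e => ∫ b in (0:ℝ)..e, f v b)
    (f₁ := fun v e => ContinuousLinearMap.toSpanSingleton ℝ (∫ b in (0:ℝ)..e, f' v b))
    (f₂ := fun v e => ContinuousLinearMap.toSpanSingleton ℝ (f v e))
    (Eventually.of_forall fun p => (hpar p.1 p.2).hasFDerivAt)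
    (Eventually.of_forall fun p => (hprim p.1 p.2).hasFDerivAt)
    ((ContinuousLinearMap.toSpanSingletonCLE (𝕜 := ℝ) (E := ℝ)).continuous.comp hpc).continuousAt
    ((ContinuousLinearMap.toSpanSingletonCLE (𝕜 := ℝ) (E := ℝ)).continuous.comp hf).continuousAt
    ).hasFDerivAt
  have := hF.comp_hasDerivAt s₀ ((hasDerivAt_id s₀).prodMk hu)
  refine this.congr_deriv ?_
  change (1:ℝ) • (∫ b in (0:ℝ)..u s₀, f' s₀ b) + u' • f s₀ (u s₀) = _
  simp [add_comm]

/-- Interchanging the order of integration over a triangle. -/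
lemma integral_triangle_swap {G : ℝ → ℝ → ℝ} (hG : Continuous ↿G) (a : ℝ) :
    ∫ c in (0:ℝ)..a, ∫ b in (0:ℝ)..(a - c), G c b
      = ∫ b in (0:ℝ)..a, ∫ c in (0:ℝ)..(a - b), G c b := by
  have key : ∀ {G : ℝ → ℝ → ℝ} (_ : Continuous ↿G) (s : ℝ),
      HasDerivAt (fun s => ∫ c in (0:ℝ)..s, ∫ b in (0:ℝ)..(s - c), G c b)
        (∫ c in (0:ℝ)..s, G c (s - c)) s := by
    intro G hG s
    have hGc : ∀ c, Continuous (G c) :=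
      fun c => hG.comp (by fun_prop : Continuous fun b => (c, b))
    have h := hasDerivAt_integral_upper (f := fun s c => ∫ b in (0:ℝ)..(s - c), G c b)
      (f' := fun s c => G c (s - c)) (u := id) (u' := 1) (s₀ := s)
      (intervalIntegral.continuous_parametric_intervalIntegral_of_continuous
        (f := fun (p : ℝ × ℝ) b => G p.2 b)
        (hG.comp (by fun_prop : Continuous fun z : (ℝ × ℝ) × ℝ => (z.1.2, z.2))) (by fun_prop))
      (hG.comp (by fun_prop : Continuous fun z : ℝ × ℝ => (z.2, z.1 - z.2)))
      (fun v c => by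
        have h1 : HasDerivAt (fun e => ∫ b in (0:ℝ)..e, G c b) (G c (v - c)) (v - c) :=
          intervalIntegral.integral_hasDerivAt_right ((hGc c).intervalIntegrable _ _)
            ((hGc c).stronglyMeasurableAtFilter _ _) (hGc c).continuousAt
        simpa using h1.comp_sub_const v c)
      (hasDerivAt_id s)
    simpa using h
  have hG' : Continuous ↿(fun b c => G c b) :=
    hG.comp (by fun_prop : Continuous fun z : ℝ × ℝ => (z.2, z.1))
  have hdiff : ∀ s, HasDerivAt (fun s => (∫ c in (0:ℝ)..s, ∫ b in (0:ℝ)..(s - c), G c b)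
      - ∫ b in (0:ℝ)..s, ∫ c in (0:ℝ)..(s - b), G c b) 0 s := by
    intro s
    refine ((key hG s).sub (key hG' s)).congr_deriv ?_
    have := intervalIntegral.integral_comp_sub_left (a := 0) (b := s) (fun c => G c (s - c)) s
    simp only [sub_sub_cancel, sub_self, sub_zero] at this
    rw [this, sub_self]
  have := is_const_of_deriv_eq_zero (fun s => (hdiff s).differentiableAt)
    (fun s => (hdiff s).deriv) a 0
  simpa [sub_eq_zero] using this

/-- The weighted zigzags with `n + 1` peaks which start at height `x + τ`, climb a total amount
`α`, stay above `x` and end there; each peak at height `y` carries the weight `q y`. -/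
def zig (q : ℝ → ℝ) : ℕ → ℝ → ℝ → ℝ → ℝ
  | 0 => fun τ α x => q (x + τ + α)
  | n + 1 => fun τ α x =>
      ∫ β in (0:ℝ)..α, q (x + τ + β) * ∫ σ in (0:ℝ)..(τ + β), zig q n σ (α - β) x

/-- The derivative of `zig q n τ α x` in `x`, where `q'` is the derivative of `q`. -/
def zigDeriv (q q' : ℝ → ℝ) : ℕ → ℝ → ℝ → ℝ → ℝ
  | 0 => fun τ α x => q' (x + τ + α)
  | n + 1 => fun τ α x =>
      ∫ β in (0:ℝ)..α, (q' (x + τ + β) * (∫ σ in (0:ℝ)..(τ + β), zig q n σ (α - β) x)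
        + q (x + τ + β) * ∫ σ in (0:ℝ)..(τ + β), zigDeriv q q' n σ (α - β) x)

/-- The convolution in `α` of `zig q i τ · x` and `zig q j 0 · x`. -/
def zigConv (q : ℝ → ℝ) (i j : ℕ) (τ α x : ℝ) : ℝ :=
  ∫ γ in (0:ℝ)..α, zig q i τ (α - γ) x * zig q j 0 γ x

/-- The sum of all convolutions `zigConv q i j` with `i + j + 1 = n`. -/
def zigConvSum (q : ℝ → ℝ) : ℕ → ℝ → ℝ → ℝ → ℝ
  | 0 => fun _ _ _ => 0
  | n + 1 => fun τ α x => ∑ p ∈ Finset.HasAntidiagonal.antidiagonal n, zigConv q p.1 p.2 τ α x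

section Zigzag

variable {q q' : ℝ → ℝ}

lemma continuous_zig_aux (hq : Continuous q) (n : ℕ) :
    Continuous fun p : ℝ × ℝ × ℝ => zig q n p.1 p.2.1 p.2.2 := by
  induction n with
  | zero => simp only [zig]; fun_prop
  | succ n ih =>
    simp only [zig]
    refine intervalIntegral.continuous_parametric_intervalIntegral_of_continuous ?_ (by fun_prop)
    refine Continuous.mul (by fun_prop) ?_
    refine intervalIntegral.continuous_parametric_intervalIntegral_of_continuous
      (f := fun (p : (ℝ × ℝ × ℝ) × ℝ) σ => zig q n σ (p.1.2.1 - p.2) p.1.2.2) ?_ (by fun_prop)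
    exact ih.comp (by fun_prop :
      Continuous fun z : ((ℝ × ℝ × ℝ) × ℝ) × ℝ => (z.2, z.1.1.2.1 - z.1.2, z.1.1.2.2))

lemma continuous_zig (hq : Continuous q) (n : ℕ) {X : Type*} [TopologicalSpace X]
    {f g h : X → ℝ} (hf : Continuous f) (hg : Continuous g) (hh : Continuous h) :
    Continuous fun p => zig q n (f p) (g p) (h p) :=
  (continuous_zig_aux hq n).comp (hf.prodMk (hg.prodMk hh))

lemma continuous_integral_zig (hq : Continuous q) (n : ℕ) {X : Type*} [TopologicalSpace X]
    [FirstCountableTopology X]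
    {f g h : X → ℝ} (hf : Continuous f) (hg : Continuous g) (hh : Continuous h) :
    Continuous fun p => ∫ σ in (0:ℝ)..f p, zig q n σ (g p) (h p) := by
  refine intervalIntegral.continuous_parametric_intervalIntegral_of_continuous
    (f := fun p σ => zig q n σ (g p) (h p)) ?_ hf
  exact continuous_zig hq n continuous_snd (hg.comp continuous_fst) (hh.comp continuous_fst)

lemma continuous_zigDeriv_aux (hq : Continuous q) (hq' : Continuous q') (n : ℕ) :
    Continuous fun p : ℝ × ℝ × ℝ => zigDeriv q q' n p.1 p.2.1 p.2.2 := by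
  induction n with
  | zero => simp only [zigDeriv]; fun_prop
  | succ n ih =>
    simp only [zigDeriv]
    refine intervalIntegral.continuous_parametric_intervalIntegral_of_continuous ?_ (by fun_prop)
    refine Continuous.add (Continuous.mul (by fun_prop) ?_) (Continuous.mul (by fun_prop) ?_)
    · exact continuous_integral_zig hq n (X := (ℝ × ℝ × ℝ) × ℝ) (by fun_prop) (by fun_prop)
        (by fun_prop)
    refine intervalIntegral.continuous_parametric_intervalIntegral_of_continuous
      (f := fun (p : (ℝ × ℝ × ℝ) × ℝ) σ => zigDeriv q q' n σ (p.1.2.1 - p.2) p.1.2.2) ?_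
      (by fun_prop)
    exact ih.comp (by fun_prop :
      Continuous fun z : ((ℝ × ℝ × ℝ) × ℝ) × ℝ => (z.2, z.1.1.2.1 - z.1.2, z.1.1.2.2))

lemma continuous_zigDeriv (hq : Continuous q) (hq' : Continuous q') (n : ℕ) {X : Type*}
    [TopologicalSpace X] {f g h : X → ℝ} (hf : Continuous f) (hg : Continuous g)
    (hh : Continuous h) : Continuous fun p => zigDeriv q q' n (f p) (g p) (h p) :=
  (continuous_zigDeriv_aux hq hq' n).comp (hf.prodMk (hg.prodMk hh))

lemma continuous_integral_zigDeriv (hq : Continuous q) (hq' : Continuous q') (n : ℕ) {X : Type*}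
    [TopologicalSpace X] [FirstCountableTopology X]
    {f g h : X → ℝ} (hf : Continuous f) (hg : Continuous g) (hh : Continuous h) :
    Continuous fun p => ∫ σ in (0:ℝ)..f p, zigDeriv q q' n σ (g p) (h p) := by
  refine intervalIntegral.continuous_parametric_intervalIntegral_of_continuous
    (f := fun p σ => zigDeriv q q' n σ (g p) (h p)) ?_ hf
  exact continuous_zigDeriv hq hq' n continuous_snd (hg.comp continuous_fst)
    (hh.comp continuous_fst)

lemma continuous_zigConv (hq : Continuous q) (i j : ℕ) {X : Type*}
    [TopologicalSpace X] [FirstCountableTopology X]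
    {f g h : X → ℝ} (hf : Continuous f) (hg : Continuous g) (hh : Continuous h) :
    Continuous fun p => zigConv q i j (f p) (g p) (h p) := by
  refine intervalIntegral.continuous_parametric_intervalIntegral_of_continuous
    (f := fun p γ => zig q i (f p) (g p - γ) (h p) * zig q j 0 γ (h p)) ?_ hg
  exact (continuous_zig hq i (X := X × ℝ) (by fun_prop) (by fun_prop) (by fun_prop)).mul
    (continuous_zig hq j (X := X × ℝ) (by fun_prop) (by fun_prop) (by fun_prop))

lemma continuous_zigConvSum (hq : Continuous q) (n : ℕ) {X : Type*}
    [TopologicalSpace X] [FirstCountableTopology X]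
    {f g h : X → ℝ} (hf : Continuous f) (hg : Continuous g) (hh : Continuous h) :
    Continuous fun p => zigConvSum q n (f p) (g p) (h p) := by
  cases n with
  | zero => exact continuous_const
  | succ n => exact continuous_finsetSum _ fun p _ => continuous_zigConv hq p.1 p.2 hf hg hh

lemma hasDerivAt_zig_base (hq' : Continuous q') (hd : ∀ y, HasDerivAt q (q' y) y) (n : ℕ)
    (τ α x : ℝ) : HasDerivAt (fun x => zig q n τ α x) (zigDeriv q q' n τ α x) x := by
  have hq : Continuous q := continuous_iff_continuousAt.2 fun y => (hd y).continuousAt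
  induction n generalizing τ α x with
  | zero =>
    simp only [zig, zigDeriv, add_assoc]
    exact (hd _).comp_add_const x (τ + α)
  | succ n ih =>
    simp only [zig, zigDeriv]
    have h := hasDerivAt_integral_upper
      (f := fun x β => q (x + τ + β) * ∫ σ in (0:ℝ)..(τ + β), zig q n σ (α - β) x)
      (f' := fun x β => q' (x + τ + β) * (∫ σ in (0:ℝ)..(τ + β), zig q n σ (α - β) x)
        + q (x + τ + β) * ∫ σ in (0:ℝ)..(τ + β), zigDeriv q q' n σ (α - β) x)
      (u := fun _ => α) (u' := 0) (s₀ := x)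
      (Continuous.mul (by fun_prop)
        (continuous_integral_zig hq n (by fun_prop) (by fun_prop) (by fun_prop)))
      (Continuous.add (Continuous.mul (by fun_prop)
        (continuous_integral_zig hq n (by fun_prop) (by fun_prop) (by fun_prop)))
        (Continuous.mul (by fun_prop)
        (continuous_integral_zigDeriv hq hq' n (by fun_prop) (by fun_prop) (by fun_prop))))
      (fun v β => by
        refine HasDerivAt.mul ?_ ?_
        · simp only [add_assoc]
          exact (hd _).comp_add_const v (τ + β)
        · have := hasDerivAt_integral_upper (f := fun s σ => zig q n σ (α - β) s)
            (f' := fun s σ => zigDeriv q q' n σ (α - β) s) (u := fun _ => τ + β) (u' := 0)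
            (s₀ := v) (continuous_zig hq n (by fun_prop) (by fun_prop) (by fun_prop))
            (continuous_zigDeriv hq hq' n (by fun_prop) (by fun_prop) (by fun_prop))
            (fun s σ => ih σ (α - β) s) (hasDerivAt_const _ _)
          simpa using this)
      (hasDerivAt_const _ _)
    simpa using h

lemma zigConv_succ (hq : Continuous q) (i j : ℕ) (τ α x : ℝ) :
    zigConv q (i + 1) j τ α x
      = ∫ β in (0:ℝ)..α, q (x + τ + β) * ∫ σ in (0:ℝ)..(τ + β), zigConv q i j σ (α - β) x := by
  have hswap : ∀ β, (∫ σ in (0:ℝ)..(τ + β), zigConv q i j σ (α - β) x)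
      = ∫ γ in (0:ℝ)..(α - β), (∫ σ in (0:ℝ)..(τ + β), zig q i σ (α - β - γ) x)
          * zig q j 0 γ x := by
    intro β
    simp only [zigConv]
    rw [intervalIntegral_intervalIntegral_swap]
    · simp only [intervalIntegral.integral_mul_const]
    · refine (ContinuousOn.integrableOn_compact (isCompact_uIcc.prod isCompact_uIcc)
        (Continuous.continuousOn ?_)).mono_set (prod_mono uIoc_subset_uIcc uIoc_subset_uIcc)
      exact (continuous_zig hq i (X := ℝ × ℝ) (by fun_prop) (by fun_prop) (by fun_prop)).mul
        (continuous_zig hq j (X := ℝ × ℝ) (by fun_prop) (by fun_prop) (by fun_prop))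
  have h := integral_triangle_swap (G := fun γ β => q (x + τ + β)
    * ((∫ σ in (0:ℝ)..(τ + β), zig q i σ (α - γ - β) x) * zig q j 0 γ x))
    (Continuous.mul (by fun_prop) (Continuous.mul
      (continuous_integral_zig hq i (by fun_prop) (by fun_prop) (by fun_prop))
      (continuous_zig hq j (by fun_prop) (by fun_prop) (by fun_prop)))) α
  simp only [hswap, ← intervalIntegral.integral_const_mul]
  simp only [sub_right_comm α] at h ⊢
  rw [← h]
  simp only [zigConv, zig, ← intervalIntegral.integral_mul_const, mul_assoc]

lemma zigConv_zero (j : ℕ) (τ α x : ℝ) :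
    zigConv q 0 j τ α x = ∫ β in (0:ℝ)..α, q (x + τ + β) * zig q j 0 (α - β) x := by
  have := intervalIntegral.integral_comp_sub_left (a := 0) (b := α)
    (fun γ => q (x + τ + (α - γ)) * zig q j 0 γ x) α
  simp only [sub_sub_cancel, sub_self, sub_zero] at this
  simp only [zigConv, zig, this]

lemma zigConvSum_succ (hq : Continuous q) (n : ℕ) (τ α x : ℝ) :
    zigConvSum q (n + 1) τ α x
      = ∫ β in (0:ℝ)..α, q (x + τ + β)
          * (zig q n 0 (α - β) x + ∫ σ in (0:ℝ)..(τ + β), zigConvSum q n σ (α - β) x) := by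
  cases n with
  | zero => simp [zigConvSum, zigConv_zero]
  | succ n =>
    have hint : ∀ p : ℕ × ℕ, IntervalIntegrable (fun β => q (x + τ + β)
        * ∫ σ in (0:ℝ)..(τ + β), zigConv q p.1 p.2 σ (α - β) x) volume 0 α := by
      intro p
      refine Continuous.intervalIntegrable (Continuous.mul (by fun_prop) ?_) _ _
      refine intervalIntegral.continuous_parametric_intervalIntegral_of_continuous
        (f := fun β σ => zigConv q p.1 p.2 σ (α - β) x) ?_ (by fun_prop)
      exact continuous_zigConv hq _ _ (X := ℝ × ℝ) (by fun_prop) (by fun_prop) (by fun_prop)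
    have hsum : ∀ β, q (x + τ + β) * ∫ σ in (0:ℝ)..(τ + β), zigConvSum q (n + 1) σ (α - β) x
        = ∑ p ∈ Finset.HasAntidiagonal.antidiagonal n,
          q (x + τ + β) * ∫ σ in (0:ℝ)..(τ + β), zigConv q p.1 p.2 σ (α - β) x := by
      intro β
      simp only [zigConvSum]
      rw [intervalIntegral.integral_finsetSum, Finset.mul_sum]
      exact fun p _ => (continuous_zigConv hq _ _ (by fun_prop) (by fun_prop)
        (by fun_prop)).intervalIntegrable _ _
    simp only [mul_add, hsum]
    rw [intervalIntegral.integral_add, intervalIntegral.integral_finsetSum (fun p _ => hint p)]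
    · rw [zigConvSum, Finset.Nat.antidiagonal_succ]
      simp [zigConv_zero, zigConv_succ hq]
    · exact (Continuous.mul (by fun_prop) (continuous_zig hq _ (by fun_prop) (by fun_prop)
        (by fun_prop))).intervalIntegrable _ _
    · rw [← Finset.sum_fn]
      exact IntervalIntegrable.sum _ fun p _ => hint p

lemma hasDerivAt_primitive {f : ℝ → ℝ} (hf : Continuous f) (e : ℝ) :
    HasDerivAt (fun e => ∫ σ in (0:ℝ)..e, f σ) (f e) e :=
  intervalIntegral.integral_hasDerivAt_right (hf.intervalIntegrable _ _)
    (hf.stronglyMeasurableAtFilter _ _) hf.continuousAt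

lemma hasDerivAt_zig_succ_start (hq' : Continuous q') (hd : ∀ y, HasDerivAt q (q' y) y) (n : ℕ)
    (τ α x : ℝ) :
    HasDerivAt (fun τ => zig q (n + 1) τ α x)
      (∫ β in (0:ℝ)..α, (q' (x + τ + β) * (∫ σ in (0:ℝ)..(τ + β), zig q n σ (α - β) x)
        + q (x + τ + β) * zig q n (τ + β) (α - β) x)) τ := by
  have hq : Continuous q := continuous_iff_continuousAt.2 fun y => (hd y).continuousAt
  have h := hasDerivAt_integral_upper
    (f := fun τ β => q (x + τ + β) * ∫ σ in (0:ℝ)..(τ + β), zig q n σ (α - β) x)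
    (f' := fun τ β => q' (x + τ + β) * (∫ σ in (0:ℝ)..(τ + β), zig q n σ (α - β) x)
      + q (x + τ + β) * zig q n (τ + β) (α - β) x)
    (u := fun _ => α) (u' := 0) (s₀ := τ)
    (Continuous.mul (by fun_prop)
      (continuous_integral_zig hq n (by fun_prop) (by fun_prop) (by fun_prop)))
    (Continuous.add (Continuous.mul (by fun_prop)
      (continuous_integral_zig hq n (by fun_prop) (by fun_prop) (by fun_prop)))
      (Continuous.mul (by fun_prop)
      (continuous_zig hq n (by fun_prop) (by fun_prop) (by fun_prop))))
    (fun v β => by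
      refine HasDerivAt.mul ?_ ?_
      · exact ((hd _).comp_add_const (x + v) β).comp_const_add x v
      · exact (hasDerivAt_primitive (continuous_zig hq n (by fun_prop) (by fun_prop)
          (by fun_prop)) (v + β)).comp_add_const v β)
    (hasDerivAt_const _ _)
  simpa [zig] using h

lemma hasDerivAt_zig_start (hq' : Continuous q') (hd : ∀ y, HasDerivAt q (q' y) y) (n : ℕ)
    (τ α x : ℝ) :
    HasDerivAt (fun τ => zig q n τ α x) (zigDeriv q q' n τ α x + zigConvSum q n τ α x) τ := by
  have hq : Continuous q := continuous_iff_continuousAt.2 fun y => (hd y).continuousAt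
  induction n generalizing τ α x with
  | zero =>
    simp only [zig, zigDeriv, zigConvSum, add_zero]
    exact ((hd _).comp_add_const (x + τ) α).comp_const_add x τ
  | succ n ih =>
    have h := hasDerivAt_zig_succ_start hq' hd n τ α x
    refine h.congr_deriv ?_
    rw [zigConvSum_succ hq, zigDeriv, ← intervalIntegral.integral_add]
    · congr 1
      ext β
      have hFTC := intervalIntegral.integral_eq_sub_of_hasDerivAt (a := 0) (b := τ + β)
        (fun σ _ => ih σ (α - β) x)
        (((continuous_zigDeriv hq hq' n (by fun_prop) (by fun_prop) (by fun_prop)).add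
          (continuous_zigConvSum hq n (by fun_prop) (by fun_prop)
            (by fun_prop))).intervalIntegrable _ _)
      rw [intervalIntegral.integral_add
        ((continuous_zigDeriv hq hq' n (by fun_prop) (by fun_prop)
          (by fun_prop)).intervalIntegrable _ _)
        ((continuous_zigConvSum hq n (by fun_prop) (by fun_prop)
          (by fun_prop)).intervalIntegrable _ _)] at hFTC
      rw [eq_sub_iff_add_eq] at hFTC
      rw [← hFTC]
      ring
    · refine Continuous.intervalIntegrable (Continuous.add (Continuous.mul (by fun_prop)
        (continuous_integral_zig hq n (by fun_prop) (by fun_prop) (by fun_prop)))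
        (Continuous.mul (by fun_prop)
        (continuous_integral_zigDeriv hq hq' n (by fun_prop) (by fun_prop) (by fun_prop)))) _ _
    · refine Continuous.intervalIntegrable (Continuous.mul (by fun_prop) (Continuous.add
        (continuous_zig hq n (by fun_prop) (by fun_prop) (by fun_prop)) ?_)) _ _
      refine intervalIntegral.continuous_parametric_intervalIntegral_of_continuous
        (f := fun β σ => zigConvSum q n σ (α - β) x) ?_ (by fun_prop)
      exact continuous_zigConvSum hq n (X := ℝ × ℝ) (by fun_prop) (by fun_prop) (by fun_prop)

lemma hasDerivAt_zig_climb (hq' : Continuous q') (hd : ∀ y, HasDerivAt q (q' y) y) (n : ℕ)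
    (α x : ℝ) :
    HasDerivAt (fun α => zig q n 0 α x) (zigDeriv q q' n 0 α x + zigConvSum q n 0 α x) α := by
  have hq : Continuous q := continuous_iff_continuousAt.2 fun y => (hd y).continuousAt
  cases n with
  | zero =>
    simp only [zig, zigDeriv, zigConvSum, add_zero]
    exact (hd _).comp_const_add x α
  | succ n =>
    have hstart := hasDerivAt_zig_start hq' hd (n + 1) 0 α x
    have hz : ∀ α, zig q (n + 1) 0 α x
        = ∫ γ in (0:ℝ)..α, q (x + (α - γ)) * ∫ σ in (0:ℝ)..(α - γ), zig q n σ γ x := by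
      intro α
      have := intervalIntegral.integral_comp_sub_left (a := 0) (b := α)
        (fun β => q (x + β) * ∫ σ in (0:ℝ)..β, zig q n σ (α - β) x) α
      simp only [sub_sub_cancel, sub_self, sub_zero] at this
      simp [zig, this]
    have hleft := hasDerivAt_zig_succ_start hq' hd n 0 α x
    have hright := hasDerivAt_integral_upper
      (f := fun α γ => q (x + (α - γ)) * ∫ σ in (0:ℝ)..(α - γ), zig q n σ γ x)
      (f' := fun α γ => q' (x + (α - γ)) * (∫ σ in (0:ℝ)..(α - γ), zig q n σ γ x)
        + q (x + (α - γ)) * zig q n (α - γ) γ x)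
      (u := id) (u' := 1) (s₀ := α)
      (Continuous.mul (by fun_prop)
        (continuous_integral_zig hq n (by fun_prop) (by fun_prop) (by fun_prop)))
      (Continuous.add (Continuous.mul (by fun_prop)
        (continuous_integral_zig hq n (by fun_prop) (by fun_prop) (by fun_prop)))
        (Continuous.mul (by fun_prop)
        (continuous_zig hq n (by fun_prop) (by fun_prop) (by fun_prop))))
      (fun v γ => by
        refine HasDerivAt.mul ?_ ?_
        · exact ((hd _).comp_const_add x (v - γ)).comp_sub_const v γ
        · exact (hasDerivAt_primitive (continuous_zig hq n (by fun_prop) (by fun_prop)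
            (by fun_prop)) (v - γ)).comp_sub_const v γ)
      (hasDerivAt_id _)
    rw [funext hz]
    refine hright.congr_deriv ?_
    have := intervalIntegral.integral_comp_sub_left (a := 0) (b := α)
      (fun β => q' (x + β) * (∫ σ in (0:ℝ)..β, zig q n σ (α - β) x)
        + q (x + β) * zig q n β (α - β) x) α
    simp only [sub_sub_cancel, sub_self, sub_zero] at this
    simp [hstart.unique hleft, this]

lemma norm_integral_le_of_exp_bound {f : ℝ → ℝ} {K l a : ℝ} (hl : 0 < l) (ha : 0 ≤ a) (hK : 0 ≤ K)
    (hf : ∀ b, 0 ≤ b → b ≤ a → |f b| ≤ K * Real.exp (l * (a - b))) :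
    |∫ b in (0:ℝ)..a, f b| ≤ K / l * Real.exp (l * a) := by
  have hc : Continuous fun b => K * Real.exp (l * (a - b)) := by fun_prop
  have hint : ∫ b in (0:ℝ)..a, K * Real.exp (l * (a - b)) = K / l * (Real.exp (l * a) - 1) := by
    rw [intervalIntegral.integral_eq_sub_of_hasDerivAt
      (f := fun b => -(K / l * Real.exp (l * (a - b))))]
    · simp; ring
    · intro b _
      have h : HasDerivAt (fun b => l * (a - b)) (l * (-1)) b :=
        ((hasDerivAt_id b).const_sub a).const_mul l
      refine (h.exp.const_mul (K / l)).neg.congr_deriv ?_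
      field_simp
    · exact hc.intervalIntegrable _ _
  calc |∫ b in (0:ℝ)..a, f b| ≤ ∫ b in (0:ℝ)..a, K * Real.exp (l * (a - b)) :=
        intervalIntegral.norm_integral_le_of_norm_le (f := f) (μ := volume) ha
          (Eventually.of_forall fun b hb => hf b hb.1.le hb.2)
          (hc.intervalIntegrable _ _)
    _ ≤ K / l * Real.exp (l * a) := by
        rw [hint]
        gcongr
        linarith

lemma abs_integral_le_of_bound {f : ℝ → ℝ} {a C T : ℝ} (ha : 0 ≤ a) (haT : a ≤ T) (hC : 0 ≤ C)
    (hf : ∀ s, 0 ≤ s → s ≤ a → |f s| ≤ C) : |∫ s in (0:ℝ)..a, f s| ≤ C * T := by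
  have := intervalIntegral.norm_integral_le_of_norm_le_const (a := 0) (b := a) (f := f) (C := C)
    (fun s hs => by
      rw [uIoc_of_le ha] at hs
      exact hf s hs.1.le hs.2)
  rw [sub_zero, abs_of_nonneg ha] at this
  exact this.trans (by gcongr)

lemma abs_zig_le {M T X l : ℝ} (hM : 0 ≤ M) (hl : 0 < l) (hlM : 4 * (M * T) ≤ l)
    (hqM : ∀ y, -X ≤ y → y ≤ X + T → |q y| ≤ M) (hqM' : ∀ y, -X ≤ y → y ≤ X + T → |q' y| ≤ M)
    (n : ℕ) (τ α x : ℝ) (hτ : 0 ≤ τ) (hα : 0 ≤ α) (hT : τ + α ≤ T) (hx : |x| ≤ X) :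
    |zig q n τ α x| ≤ M * (1 / 2) ^ n * Real.exp (l * α) ∧
      |zigDeriv q q' n τ α x| ≤ M * (1 / 2) ^ n * Real.exp (l * α) := by
  have hx' := abs_le.1 hx
  induction n generalizing τ α with
  | zero =>
    have h1 : 1 ≤ Real.exp (l * α) := Real.one_le_exp (by positivity)
    have h2 : M ≤ M * Real.exp (l * α) := le_mul_of_one_le_right hM h1
    simp only [zig, zigDeriv, pow_zero, mul_one]
    exact ⟨(hqM _ (by linarith) (by linarith)).trans h2,
      (hqM' _ (by linarith) (by linarith)).trans h2⟩
  | succ n ih =>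
    have hT0 : 0 ≤ T := by linarith
    have hbound : ∀ b, 0 ≤ b → b ≤ α →
        |∫ σ in (0:ℝ)..(τ + b), zig q n σ (α - b) x|
            ≤ M * (1 / 2) ^ n * Real.exp (l * (α - b)) * T ∧
          |∫ σ in (0:ℝ)..(τ + b), zigDeriv q q' n σ (α - b) x|
            ≤ M * (1 / 2) ^ n * Real.exp (l * (α - b)) * T := fun b hb hb' =>
      ⟨abs_integral_le_of_bound (by linarith) (by linarith) (by positivity)
        fun s hs hs' => (ih s (α - b) hs (by linarith) (by linarith)).1,
      abs_integral_le_of_bound (by linarith) (by linarith) (by positivity)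
        fun s hs hs' => (ih s (α - b) hs (by linarith) (by linarith)).2⟩
    have hratio : M * T / l ≤ 1 / 4 := by
      rw [div_le_iff₀ hl]
      linarith
    have hfin : 2 * (M * (M * (1 / 2) ^ n * T)) / l * Real.exp (l * α)
        ≤ M * (1 / 2) ^ (n + 1) * Real.exp (l * α) := by
      gcongr
      calc 2 * (M * (M * (1 / 2) ^ n * T)) / l = 2 * (M * (1 / 2) ^ n) * (M * T / l) := by ring
        _ ≤ 2 * (M * (1 / 2) ^ n) * (1 / 4) := by gcongr
        _ = M * (1 / 2) ^ (n + 1) := by ring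
    have hterm : ∀ b u w, 0 ≤ b → b ≤ α → |u| ≤ M →
        |w| ≤ M * (1 / 2) ^ n * Real.exp (l * (α - b)) * T →
        |u * w| ≤ M * (M * (1 / 2) ^ n * T) * Real.exp (l * (α - b)) := by
      intro b u w _ _ hu hw
      rw [abs_mul]
      calc |u| * |w| ≤ M * (M * (1 / 2) ^ n * Real.exp (l * (α - b)) * T) := by gcongr
        _ = _ := by ring
    constructor
    · refine (norm_integral_le_of_exp_bound (K := 2 * (M * (M * (1 / 2) ^ n * T)))
        hl hα (by positivity) fun b hb hb' => ?_).trans hfin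
      refine (hterm b _ _ hb hb' (hqM _ (by linarith) (by linarith)) (hbound b hb hb').1).trans ?_
      have : 0 ≤ M * (M * (1 / 2) ^ n * T) := by positivity
      exact mul_le_mul_of_nonneg_right (by linarith) (Real.exp_pos _).le
    · refine (norm_integral_le_of_exp_bound (K := 2 * (M * (M * (1 / 2) ^ n * T)))
        hl hα (by positivity) fun b hb hb' => ?_).trans hfin
      refine (abs_add_le _ _).trans ?_
      have h1 := hterm b _ _ hb hb' (hqM' (x + τ + b) (by linarith) (by linarith))
        (hbound b hb hb').1
      have h2 := hterm b _ _ hb hb' (hqM (x + τ + b) (by linarith) (by linarith))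
        (hbound b hb hb').2
      linarith

lemma exists_summable_zig_bound (hq : Continuous q) (hq' : Continuous q') (T X : ℝ) (hT : 0 ≤ T) :
    ∃ u : ℕ → ℝ, Summable u ∧ ∀ n α x, 0 ≤ α → α ≤ T → |x| ≤ X →
      |zig q n 0 α x| ≤ u n ∧ |zigDeriv q q' n 0 α x| ≤ u n ∧ |zigConvSum q n 0 α x| ≤ u n := by
  obtain ⟨M₁, hM₁⟩ := (isCompact_Icc (a := -X) (b := X + T)).exists_bound_of_continuousOn
    hq.continuousOn
  obtain ⟨M₂, hM₂⟩ := (isCompact_Icc (a := -X) (b := X + T)).exists_bound_of_continuousOn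
    hq'.continuousOn
  set M := max 0 (max M₁ M₂) with hMdef
  have hM : 0 ≤ M := le_max_left _ _
  set l := 4 * (M * T) + 1 with hldef
  have hl : 0 < l := by positivity
  set E := Real.exp (l * T) with hE
  have hE0 : 0 < E := Real.exp_pos _
  have hz := abs_zig_le (q := q) (q' := q') (X := X) hM hl (by linarith : 4 * (M * T) ≤ l)
    (fun y h1 h2 => (hM₁ y ⟨h1, h2⟩).trans ((le_max_left _ _).trans (le_max_right _ _)))
    (fun y h1 h2 => (hM₂ y ⟨h1, h2⟩).trans ((le_max_right _ _).trans (le_max_right _ _)))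
  have hsum : Summable fun n : ℕ => (n : ℝ) * (1 / 2 : ℝ) ^ n := by
    simpa using summable_pow_mul_geometric_of_norm_lt_one (R := ℝ) 1 (r := 1 / 2) (by norm_num)
  have hsum' : Summable fun n : ℕ => (1 / 2 : ℝ) ^ n :=
    summable_geometric_of_lt_one (by norm_num) (by norm_num)
  refine ⟨fun n => M * E * (1 / 2) ^ n + 2 * M * M * E * T * (n * (1 / 2) ^ n),
    (hsum'.mul_left _).add (hsum.mul_left _), fun n α x hα hαT hx => ?_⟩
  have hexp : Real.exp (l * α) ≤ E := Real.exp_le_exp.2 (by gcongr)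
  have hfst : M * (1 / 2) ^ n * Real.exp (l * α)
      ≤ M * E * (1 / 2) ^ n + 2 * M * M * E * T * (n * (1 / 2) ^ n) := by
    have h1 : M * (1 / 2) ^ n * Real.exp (l * α) ≤ M * (1 / 2) ^ n * E := by gcongr
    have h2 : 0 ≤ 2 * M * M * E * T * (n * (1 / 2) ^ n) := by positivity
    linarith
  refine ⟨(hz n 0 α x le_rfl hα (by linarith) hx).1.trans hfst,
    (hz n 0 α x le_rfl hα (by linarith) hx).2.trans hfst, ?_⟩
  cases n with
  | zero => simp only [zigConvSum, abs_zero]; positivity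
  | succ n =>
    have hconv : ∀ p ∈ Finset.HasAntidiagonal.antidiagonal n,
        |zigConv q p.1 p.2 0 α x| ≤ M * M * (1 / 2) ^ n * E * T := by
      intro p hp
      refine abs_integral_le_of_bound hα hαT (by positivity) fun s hs hs' => ?_
      rw [abs_mul]
      calc |zig q p.1 0 (α - s) x| * |zig q p.2 0 s x|
          ≤ (M * (1 / 2) ^ p.1 * Real.exp (l * (α - s)))
              * (M * (1 / 2) ^ p.2 * Real.exp (l * s)) :=
            mul_le_mul (hz _ 0 _ x le_rfl (by linarith) (by linarith) hx).1
              (hz _ 0 _ x le_rfl hs (by linarith) hx).1 (abs_nonneg _) (by positivity)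
        _ = M * M * (1 / 2) ^ (p.1 + p.2) * Real.exp (l * (α - s) + l * s) := by
            rw [Real.exp_add, pow_add]; ring
        _ ≤ M * M * (1 / 2) ^ n * E := by
            rw [Finset.HasAntidiagonal.mem_antidiagonal.1 hp,
              show l * (α - s) + l * s = l * α by ring]
            gcongr
    calc |zigConvSum q (n + 1) 0 α x|
        ≤ ∑ p ∈ Finset.HasAntidiagonal.antidiagonal n, |zigConv q p.1 p.2 0 α x| :=
          Finset.abs_sum_le_sum_abs _ _
      _ ≤ (n + 1) * (M * M * (1 / 2) ^ n * E * T) := by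
          have := Finset.sum_le_card_nsmul _ _ _ hconv
          simpa using this
      _ = 2 * M * M * E * T * ((n + 1 : ℕ) * (1 / 2) ^ (n + 1)) := by push_cast; ring
      _ ≤ _ := le_add_of_nonneg_left (by positivity)

/-- The alternating sum of all zigzag integrals which start at the bottom. -/
def zigSum (q : ℝ → ℝ) (α x : ℝ) : ℝ := ∑' n, (-1) ^ n * zig q n 0 α x

lemma hasFDerivAt_zig (hq' : Continuous q') (hd : ∀ y, HasDerivAt q (q' y) y) (n : ℕ)
    (p : ℝ × ℝ) :
    HasFDerivAt (fun p : ℝ × ℝ => zig q n 0 p.1 p.2)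
      ((zigDeriv q q' n 0 p.1 p.2 + zigConvSum q n 0 p.1 p.2) • ContinuousLinearMap.fst ℝ ℝ ℝ
        + zigDeriv q q' n 0 p.1 p.2 • ContinuousLinearMap.snd ℝ ℝ ℝ) p := by
  have hq : Continuous q := continuous_iff_continuousAt.2 fun y => (hd y).continuousAt
  have hD : Continuous fun p : ℝ × ℝ => zigDeriv q q' n 0 p.1 p.2 :=
    continuous_zigDeriv hq hq' n (by fun_prop) (by fun_prop) (by fun_prop)
  have hC : Continuous fun p : ℝ × ℝ => zigConvSum q n 0 p.1 p.2 :=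
    continuous_zigConvSum hq n (by fun_prop) (by fun_prop) (by fun_prop)
  have h := (hasStrictFDerivAt_uncurry_coprod (𝕜 := ℝ) (u := p)
    (f := fun α x => zig q n 0 α x)
    (f₁ := fun α x => ContinuousLinearMap.toSpanSingleton ℝ
      (zigDeriv q q' n 0 α x + zigConvSum q n 0 α x))
    (f₂ := fun α x => ContinuousLinearMap.toSpanSingleton ℝ (zigDeriv q q' n 0 α x))
    (Eventually.of_forall fun p => (hasDerivAt_zig_climb hq' hd n p.1 p.2).hasFDerivAt)
    (Eventually.of_forall fun p => (hasDerivAt_zig_base hq' hd n 0 p.1 p.2).hasFDerivAt)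
    ((ContinuousLinearMap.toSpanSingletonCLE (𝕜 := ℝ) (E := ℝ)).continuous.comp
      (hD.add hC)).continuousAt
    ((ContinuousLinearMap.toSpanSingletonCLE (𝕜 := ℝ) (E := ℝ)).continuous.comp hD).continuousAt
    ).hasFDerivAt
  refine h.congr_fderiv ?_
  ext <;> simp [Function.HasUncurry.uncurry]

/-- The derivative of `zig q n 0` as a function of the climb and the base, with sign. -/
def zigFDeriv (q q' : ℝ → ℝ) (n : ℕ) (p : ℝ × ℝ) : ℝ × ℝ →L[ℝ] ℝ :=
  ((-1 : ℝ) ^ n) • ((zigDeriv q q' n 0 p.1 p.2 + zigConvSum q n 0 p.1 p.2)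
      • ContinuousLinearMap.fst ℝ ℝ ℝ
    + zigDeriv q q' n 0 p.1 p.2 • ContinuousLinearMap.snd ℝ ℝ ℝ)

lemma norm_zigFDeriv_le {n : ℕ} {p : ℝ × ℝ} {u : ℝ} (hD : |zigDeriv q q' n 0 p.1 p.2| ≤ u)
    (hC : |zigConvSum q n 0 p.1 p.2| ≤ u) : ‖zigFDeriv q q' n p‖ ≤ 3 * u := by
  rw [zigFDeriv, norm_smul]
  simp only [norm_pow, norm_neg, norm_one, one_pow, one_mul]
  refine (norm_add_le _ _).trans ?_
  rw [norm_smul, norm_smul]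
  have h1 : ‖ContinuousLinearMap.fst ℝ ℝ ℝ‖ ≤ 1 := ContinuousLinearMap.norm_fst_le ..
  have h2 : ‖ContinuousLinearMap.snd ℝ ℝ ℝ‖ ≤ 1 := ContinuousLinearMap.norm_snd_le ..
  have h3 := (norm_add_le (zigDeriv q q' n 0 p.1 p.2) (zigConvSum q n 0 p.1 p.2)).trans
    (add_le_add hD hC)
  have h4 := mul_le_mul h3 h1 (norm_nonneg _) ((norm_nonneg _).trans h3)
  have h5 := mul_le_mul hD h2 (norm_nonneg _) ((abs_nonneg _).trans hD)
  rw [Real.norm_eq_abs (zigDeriv q q' n 0 p.1 p.2)]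
  linarith

lemma exists_nhds_zigSum (hq' : Continuous q') (hd : ∀ y, HasDerivAt q (q' y) y) (p : ℝ × ℝ)
    (hp : 0 < p.1) :
    ∃ s ∈ nhds p, ContinuousOn (fun p => ∑' n, zigFDeriv q q' n p) s ∧
      ∀ p ∈ s, Summable (fun n => zigFDeriv q q' n p) ∧
        HasFDerivAt (fun p : ℝ × ℝ => zigSum q p.1 p.2) (∑' n, zigFDeriv q q' n p) p := by
  have hq : Continuous q := continuous_iff_continuousAt.2 fun y => (hd y).continuousAt
  obtain ⟨u, hu, hb⟩ := exists_summable_zig_bound hq hq' (p.1 + 1) (|p.2| + 1) (by linarith)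
  set s : Set (ℝ × ℝ) := Ioo 0 (p.1 + 1) ×ˢ Ioo (-(|p.2| + 1)) (|p.2| + 1) with hs
  have hso : IsOpen s := isOpen_Ioo.prod isOpen_Ioo
  have hps : p ∈ s := ⟨⟨hp, by linarith⟩, abs_lt.1 (by linarith)⟩
  have hsb : ∀ n, ∀ r ∈ s, |zig q n 0 r.1 r.2| ≤ u n ∧ |zigDeriv q q' n 0 r.1 r.2| ≤ u n ∧
      |zigConvSum q n 0 r.1 r.2| ≤ u n :=
    fun n r hr => hb n r.1 r.2 hr.1.1.le hr.1.2.le (abs_lt.2 hr.2).le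
  have hnorm : ∀ n, ∀ r ∈ s, ‖zigFDeriv q q' n r‖ ≤ 3 * u n :=
    fun n r hr => norm_zigFDeriv_le (hsb n r hr).2.1 (hsb n r hr).2.2
  refine ⟨s, hso.mem_nhds hps, continuousOn_tsum (fun n => ?_) (hu.mul_left 3) hnorm, ?_⟩
  · have hD : Continuous fun p : ℝ × ℝ => zigDeriv q q' n 0 p.1 p.2 :=
      continuous_zigDeriv hq hq' n (by fun_prop) (by fun_prop) (by fun_prop)
    have hC : Continuous fun p : ℝ × ℝ => zigConvSum q n 0 p.1 p.2 :=
      continuous_zigConvSum hq n (by fun_prop) (by fun_prop) (by fun_prop)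
    unfold zigFDeriv
    fun_prop
  · intro r hr
    refine ⟨Summable.of_norm_bounded (hu.mul_left 3) fun n => hnorm n r hr, ?_⟩
    refine hasFDerivAt_tsum_of_isPreconnected
      (f := fun n (p : ℝ × ℝ) => (-1) ^ n * zig q n 0 p.1 p.2)
      (f' := zigFDeriv q q') (hu.mul_left 3) hso
      (((convex_Ioo _ _).prod (convex_Ioo _ _)).isPreconnected)
      (fun n r _ => (hasFDerivAt_zig hq' hd n r).const_mul _) hnorm hps ?_ hr
    refine Summable.of_norm_bounded hu fun n => ?_
    simpa [abs_mul] using (hsb n p hps).1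

lemma contDiffAt_zigSum (hq' : Continuous q') (hd : ∀ y, HasDerivAt q (q' y) y) (p : ℝ × ℝ)
    (hp : 0 < p.1) : ContDiffAt ℝ 1 (fun p : ℝ × ℝ => zigSum q p.1 p.2) p := by
  obtain ⟨s, hs, hc, h⟩ := exists_nhds_zigSum hq' hd p hp
  exact contDiffAt_one_iff.2 ⟨_, s, hs, hc, fun r hr => (h r hr).2⟩

lemma hasSum_zigConvSum (hq : Continuous q) (α x : ℝ) (hα : 0 ≤ α) :
    HasSum (fun n => (-1) ^ n * zigConvSum q (n + 1) 0 α x)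
      (∫ β in (0:ℝ)..α, zigSum q β x * zigSum q (α - β) x) := by
  obtain ⟨u, hu, hb⟩ := exists_summable_zig_bound hq hq α |x| hα
  have hu' : Summable fun n => ‖u n‖ := hu.norm
  have hsummable : ∀ β, 0 ≤ β → β ≤ α → Summable fun n => ‖(-1) ^ n * zig q n 0 β x‖ := by
    intro β h0 h1
    refine Summable.of_nonneg_of_le (fun n => norm_nonneg _) (fun n => ?_) hu
    simpa [abs_mul] using (hb n β x h0 h1 le_rfl).1
  have hterm : ∀ n, (-1) ^ n * zigConvSum q (n + 1) 0 α x
      = ∫ β in (0:ℝ)..α, ∑ p ∈ Finset.HasAntidiagonal.antidiagonal n,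
        ((-1) ^ p.1 * zig q p.1 0 (α - β) x) * ((-1) ^ p.2 * zig q p.2 0 β x) := by
    intro n
    rw [intervalIntegral.integral_finsetSum, zigConvSum, Finset.mul_sum]
    · refine Finset.sum_congr rfl fun p hp => ?_
      rw [zigConv, ← intervalIntegral.integral_const_mul,
        ← Finset.HasAntidiagonal.mem_antidiagonal.1 hp]
      congr 1
      ext β
      ring
    · intro p _
      refine Continuous.intervalIntegrable (Continuous.mul ?_ ?_) _ _
      · exact continuous_const.mul (continuous_zig hq _ (by fun_prop) (by fun_prop) (by fun_prop))
      · exact continuous_const.mul (continuous_zig hq _ (by fun_prop) (by fun_prop) (by fun_prop))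
  simp only [hterm]
  refine intervalIntegral.hasSum_integral_of_dominated_convergence
    (fun n _ => ∑ p ∈ Finset.HasAntidiagonal.antidiagonal n, ‖u p.1‖ * ‖u p.2‖)
    (fun n => ?_) (fun n => ?_) ?_ ?_ ?_
  · refine Continuous.aestronglyMeasurable (continuous_finsetSum _ fun p _ => Continuous.mul ?_ ?_)
    · exact continuous_const.mul (continuous_zig hq _ (by fun_prop) (by fun_prop) (by fun_prop))
    · exact continuous_const.mul (continuous_zig hq _ (by fun_prop) (by fun_prop) (by fun_prop))
  · refine Eventually.of_forall fun β hβ => ?_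
    rw [uIoc_of_le hα] at hβ
    refine (norm_sum_le _ _).trans (Finset.sum_le_sum fun p _ => ?_)
    rw [norm_mul]
    have h1 := (hb p.1 (α - β) x (by linarith [hβ.2]) (by linarith [hβ.1]) le_rfl).1
    have h2 := (hb p.2 β x hβ.1.le hβ.2 le_rfl).1
    refine mul_le_mul ?_ ?_ (norm_nonneg _) (norm_nonneg _)
    · simpa [abs_mul] using h1.trans (le_abs_self _)
    · simpa [abs_mul] using h2.trans (le_abs_self _)
  · refine Eventually.of_forall fun β _ => ?_
    exact (summable_norm_sum_mul_antidiagonal_of_summable_norm (f := fun n => ‖u n‖)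
      (g := fun n => ‖u n‖) (by simpa using hu') (by simpa using hu')).of_norm
  · exact intervalIntegrable_const
  · refine Eventually.of_forall fun β hβ => ?_
    rw [uIoc_of_le hα] at hβ
    have hs1 := hsummable (α - β) (by linarith [hβ.2]) (by linarith [hβ.1])
    have hs2 := hsummable β hβ.1.le hβ.2
    rw [mul_comm, zigSum, zigSum, tsum_mul_tsum_eq_tsum_sum_antidiagonal_of_summable_norm hs1 hs2]
    exact (summable_norm_sum_mul_antidiagonal_of_summable_norm hs1 hs2).of_norm.hasSum

/-- The sum of the zigzag integrals satisfies the integro-differential equation. -/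
lemma deriv_zigSum (hq' : Continuous q') (hd : ∀ y, HasDerivAt q (q' y) y) (α x : ℝ)
    (hα : 0 < α) :
    deriv (fun t => zigSum q α t) x = deriv (fun s => zigSum q s x) α +
      ∫ β in (0:ℝ)..α, zigSum q β x * zigSum q (α - β) x := by
  have hq : Continuous q := continuous_iff_continuousAt.2 fun y => (hd y).continuousAt
  obtain ⟨s, hs, -, h⟩ := exists_nhds_zigSum hq' hd (α, x) hα
  obtain ⟨hsum, hF⟩ := h (α, x) (mem_of_mem_nhds hs)
  have h1 : HasDerivAt (fun t => zigSum q α t) ((∑' n, zigFDeriv q q' n (α, x)) (0, 1)) x :=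
    hF.comp_hasDerivAt (f := fun t : ℝ => (α, t)) x
      ((hasDerivAt_const x α).prodMk (hasDerivAt_id' x))
  have h2 : HasDerivAt (fun s => zigSum q s x) ((∑' n, zigFDeriv q q' n (α, x)) (1, 0)) α :=
    hF.comp_hasDerivAt (f := fun s : ℝ => (s, x)) α
      ((hasDerivAt_id' α).prodMk (hasDerivAt_const α x))
  rw [h1.deriv, h2.deriv]
  have h3 := (ContinuousLinearMap.apply ℝ ℝ ((0:ℝ), (1:ℝ))).hasSum hsum.hasSum
  have h4 := (ContinuousLinearMap.apply ℝ ℝ ((1:ℝ), (0:ℝ))).hasSum hsum.hasSum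
  have h5 := h3.sub h4
  have h6 := hasSum_zigConvSum hq α x hα.le
  have h7 : ∀ n, (ContinuousLinearMap.apply ℝ ℝ ((0:ℝ), (1:ℝ))) (zigFDeriv q q' n (α, x))
      - (ContinuousLinearMap.apply ℝ ℝ ((1:ℝ), (0:ℝ))) (zigFDeriv q q' n (α, x))
      = -((-1) ^ n * zigConvSum q n 0 α x) := by
    intro n
    simp [zigFDeriv]
    ring
  simp only [h7] at h5
  rw [← hasSum_nat_add_iff' 1] at h5
  simp only [pow_succ, mul_neg, mul_one, neg_mul, neg_neg, Finset.sum_range_one, zigConvSum,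
    mul_zero, neg_zero, sub_zero] at h5
  have h8 := h5.unique h6
  simp only [ContinuousLinearMap.apply_apply] at h8
  linarith

end Zigzag

/-! ### The integrals over the regions `R_n(α)` as zigzag integrals -/

lemma measurePreserving_finCons (n : ℕ) :
    MeasurePreserving fun z : ℝ × (Fin n → ℝ) => (Fin.cons z.1 z.2 : Fin (n + 1) → ℝ) := by
  have h := (volume_preserving_piFinSuccAbove (fun _ : Fin (n + 1) => ℝ) 0).symm
  have heq : (fun z : ℝ × (Fin n → ℝ) => (Fin.cons z.1 z.2 : Fin (n + 1) → ℝ))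
      = (MeasurableEquiv.piFinSuccAbove (fun _ : Fin (n + 1) => ℝ) 0).symm := by
    ext z i
    simp [MeasurableEquiv.piFinSuccAbove]
  rw [heq]
  exact h

lemma MeasureTheory.MeasurePreserving.integrable_comp_and_integral_comp {X Y : Type*}
    [MeasureSpace X] [MeasureSpace Y] {f : X → Y} (hf : MeasurePreserving f) {F : Y → ℝ}
    (hF : Integrable F) : Integrable (fun z => F (f z)) ∧ ∫ z, F (f z) = ∫ y, F y := by
  refine ⟨(hf.integrable_comp hF.aestronglyMeasurable).2 hF, ?_⟩
  rw [← hf.map_eq] at hF ⊢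
  exact (integral_map hf.measurable.aemeasurable hF.aestronglyMeasurable).symm

lemma integral_finCons_fst {n m : ℕ} {F : (Fin (n + 1) → ℝ) × (Fin m → ℝ) → ℝ}
    (hF : Integrable F) :
    ∫ p, F p = ∫ x : ℝ, ∫ w : (Fin n → ℝ) × (Fin m → ℝ), F (Fin.cons x w.1, w.2) := by
  have hmp : MeasurePreserving fun z : ℝ × ((Fin n → ℝ) × (Fin m → ℝ)) =>
      ((Fin.cons z.1 z.2.1 : Fin (n + 1) → ℝ), z.2.2) :=
    ((measurePreserving_finCons n).prod (MeasurePreserving.id volume)).comp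
      volume_preserving_prodAssoc.symm
  obtain ⟨h1, h2⟩ := hmp.integrable_comp_and_integral_comp hF
  rw [← h2]
  exact integral_prod _ h1

lemma measurePreserving_prodProdProdComm (X Y Z W : Type*) [MeasureSpace X] [MeasureSpace Y]
    [MeasureSpace Z] [MeasureSpace W] [SFinite (volume : Measure X)]
    [SFinite (volume : Measure Y)] [SFinite (volume : Measure Z)] [SFinite (volume : Measure W)] :
    MeasurePreserving fun z : (X × Y) × Z × W => ((z.1.1, z.2.1), (z.1.2, z.2.2)) := by
  have h1 : MeasurePreserving fun z : Y × Z × W => (z.2.1, (z.1, z.2.2)) :=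
    (volume_preserving_prodAssoc.comp
      ((Measure.measurePreserving_swap (μ := (volume : Measure Y)) (ν := (volume : Measure Z))).prod
        (MeasurePreserving.id (volume : Measure W)))).comp volume_preserving_prodAssoc.symm
  exact (volume_preserving_prodAssoc.symm.comp
    ((MeasurePreserving.id (volume : Measure X)).prod h1)).comp volume_preserving_prodAssoc

lemma integral_finCons_finCons {n m : ℕ} {F : (Fin (n + 1) → ℝ) × (Fin (m + 1) → ℝ) → ℝ}
    (hF : Integrable F) :
    Integrable (fun z : ℝ × ℝ => ∫ w : (Fin n → ℝ) × (Fin m → ℝ),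
        F (Fin.cons z.1 w.1, Fin.cons z.2 w.2)) ∧
      ∫ p, F p = ∫ z : ℝ × ℝ, ∫ w : (Fin n → ℝ) × (Fin m → ℝ),
        F (Fin.cons z.1 w.1, Fin.cons z.2 w.2) := by
  have hmp : MeasurePreserving fun z : (ℝ × ℝ) × ((Fin n → ℝ) × (Fin m → ℝ)) =>
      ((Fin.cons z.1.1 z.2.1 : Fin (n + 1) → ℝ), (Fin.cons z.1.2 z.2.2 : Fin (m + 1) → ℝ)) :=
    ((measurePreserving_finCons n).prod (measurePreserving_finCons m)).comp
      (measurePreserving_prodProdProdComm ℝ ℝ (Fin n → ℝ) (Fin m → ℝ))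
  obtain ⟨h1, h2⟩ := hmp.integrable_comp_and_integral_comp hF
  rw [← h2]
  exact ⟨h1.integral_prod_left, integral_prod _ h1⟩

lemma mem_Rregion_zero {p : (Fin 2 → ℝ) × (Fin 0 → ℝ)} {α : ℝ} :
    p ∈ Rregion 0 α ↔
      (0 ≤ p.1 0 ∧ 0 ≤ p.1 1) ∧ p.1 0 ≤ α ∧ p.1 1 ≤ α ∧ α ≤ p.1 0 + p.1 1 := by
  simp only [Rregion, mem_ofPred_eq, IsEmpty.forall_iff, true_and, Finset.univ_eq_empty,
    Finset.sum_empty, sub_zero, abs_le]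
  change ((∀ i : Fin 2, 0 ≤ p.1 i) ∧ (-(2 * α - p.1 0 - p.1 1) ≤ p.1 0 - p.1 1 ∧
    p.1 0 - p.1 1 ≤ 2 * α - p.1 0 - p.1 1) ∧ 2 * α - p.1 0 - p.1 1 ≤ p.1 0 + p.1 1) ↔ _
  rw [Fin.forall_fin_two]
  refine and_congr_right fun _ => ⟨?_, ?_⟩
  · rintro ⟨⟨h1, h2⟩, h3⟩
    exact ⟨by linarith, by linarith, by linarith⟩
  · rintro ⟨h1, h2, h3⟩
    exact ⟨⟨by linarith, by linarith⟩, by linarith⟩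

lemma mem_Rregion_cons_cons {k : ℕ} {y l α : ℝ} {u : Fin (k + 2) → ℝ} {v : Fin k → ℝ} :
    ((Fin.cons y u, Fin.cons l v) : (Fin (k + 3) → ℝ) × (Fin (k + 1) → ℝ)) ∈ Rregion (k + 1) α ↔
      (0 ≤ y ∧ |y - u 0| ≤ l ∧ l ≤ y + u 0) ∧ (u, v) ∈ Rregion k (α + (u 0 - y - l) / 2) := by
  simp only [Rregion, mem_ofPred_eq, Fin.forall_fin_succ (n := k + 2), Fin.forall_fin_succ (n := k),
    Fin.sum_univ_succ, Fin.cons_zero, Fin.cons_succ]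
  have h1 : ∀ h : 0 < k + 2, u ⟨0, h⟩ = u 0 := fun _ => rfl
  have h2 : 2 * α - y - u ⟨k + 1, by omega⟩ - (l + ∑ j, v j)
      = 2 * (α + (u 0 - y - l) / 2) - u 0 - u ⟨k + 1, by omega⟩ - ∑ j, v j := by ring
  change ((0 ≤ y ∧ ∀ i, 0 ≤ u i) ∧ ((|y - u 0| ≤ l ∧ l ≤ y + u 0) ∧ ∀ i : Fin k,
      |u (Fin.castLE (by omega) i) - u (Fin.castLE (by omega) i.succ)| ≤ v i ∧
      v i ≤ u (Fin.castLE (by omega) i) + u (Fin.castLE (by omega) i.succ)) ∧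
    |u ⟨k, by omega⟩ - u ⟨k + 1, by omega⟩| ≤ 2 * α - y - u ⟨k + 1, by omega⟩ - (l + ∑ j, v j) ∧
    2 * α - y - u ⟨k + 1, by omega⟩ - (l + ∑ j, v j) ≤ u ⟨k, by omega⟩ + u ⟨k + 1, by omega⟩) ↔ _
  rw [h2]
  simp only [h1]
  tauto

lemma isClosed_Rregion (k : ℕ) (α : ℝ) : IsClosed (Rregion k α) := by
  simp only [Rregion, ofPred_and, ofPred_forall]
  refine IsClosed.inter (isClosed_iInter fun i => isClosed_le (by fun_prop) (by fun_prop))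
    (IsClosed.inter (isClosed_iInter fun i => IsClosed.inter ?_ ?_) (IsClosed.inter ?_ ?_))
  all_goals exact isClosed_le (by fun_prop) (by fun_prop)

lemma Rregion_subset_Icc (k : ℕ) (α : ℝ) :
    Rregion k α ⊆ Icc ((fun _ => 0), (fun _ => 0)) ((fun _ => α), (fun _ => 2 * α)) := by
  induction k generalizing α with
  | zero =>
    intro p hp
    obtain ⟨⟨h0, h1⟩, h2, h3, -⟩ := mem_Rregion_zero.1 hp
    exact ⟨⟨Fin.forall_fin_two.2 ⟨h0, h1⟩, fun i => i.elim0⟩,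
      ⟨Fin.forall_fin_two.2 ⟨h2, h3⟩, fun i => i.elim0⟩⟩
  | succ k ih =>
    rintro ⟨s, t⟩ hp
    obtain ⟨y, u, rfl⟩ : ∃ y u, s = Fin.cons y u := ⟨s 0, Fin.tail s, (Fin.cons_self_tail s).symm⟩
    obtain ⟨l, v, rfl⟩ : ∃ l v, t = Fin.cons l v := ⟨t 0, Fin.tail t, (Fin.cons_self_tail t).symm⟩
    obtain ⟨⟨h0, h1, h2⟩, h3⟩ := mem_Rregion_cons_cons.1 hp
    obtain ⟨⟨h4, h5⟩, h6, h7⟩ := ih _ h3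
    have h1' := abs_le.1 h1
    have h40 : 0 ≤ u 0 := h4 0
    have h60 : u 0 ≤ α + (u 0 - y - l) / 2 := h6 0
    refine ⟨⟨fun i => ?_, fun i => ?_⟩, fun i => ?_, fun i => ?_⟩
    · exact Fin.cases h0 h4 i
    · exact Fin.cases ((abs_nonneg _).trans h1) h5 i
    · refine Fin.cases ?_ (fun j => ?_) i
      · change y ≤ α
        linarith
      · have : u j ≤ α + (u 0 - y - l) / 2 := h6 j
        change u j ≤ α
        linarith
    · refine Fin.cases ?_ (fun j => ?_) i
      · change l ≤ 2 * α
        linarith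
      · have : v j ≤ 2 * (α + (u 0 - y - l) / 2) := h7 j
        change v j ≤ 2 * α
        linarith

/-- The slice of `Rregion k α` on which the first coordinate equals `y`. -/
def Rslice (k : ℕ) (y α : ℝ) : Set ((Fin (k + 1) → ℝ) × (Fin k → ℝ)) :=
  {p | (Fin.cons y p.1, p.2) ∈ Rregion k α}

lemma isClosed_Rslice (k : ℕ) (y α : ℝ) : IsClosed (Rslice k y α) := by
  refine (isClosed_Rregion k α).preimage (Continuous.prodMk ?_ continuous_snd)
  exact continuous_pi fun i => Fin.cases continuous_const (fun j => by simp; fun_prop) i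

lemma Rslice_subset_Icc (k : ℕ) (y α : ℝ) :
    Rslice k y α ⊆ Icc ((fun _ => 0), (fun _ => 0)) ((fun _ => α), (fun _ => 2 * α)) := by
  intro p hp
  obtain ⟨⟨h1, h2⟩, h3, h4⟩ := Rregion_subset_Icc k α hp
  exact ⟨⟨fun i => h1 i.succ, h2⟩, fun i => h3 i.succ, h4⟩

lemma mem_Rslice_succ {k : ℕ} {x y l α : ℝ} {w : (Fin (k + 1) → ℝ) × (Fin k → ℝ)} :
    (Fin.cons x w.1, Fin.cons l w.2) ∈ Rslice (k + 1) y α ↔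
      (0 ≤ y ∧ |y - x| ≤ l ∧ l ≤ y + x) ∧ w ∈ Rslice k x (α + (x - y - l) / 2) := by
  simp only [Rslice, mem_ofPred_eq, mem_Rregion_cons_cons, Fin.cons_zero]

lemma integrable_indicator_prod {q : ℝ → ℝ} (hq : Continuous q) {n m : ℕ}
    {s : Set ((Fin n → ℝ) × (Fin m → ℝ))} (hs : IsClosed s) {a b : (Fin n → ℝ) × (Fin m → ℝ)}
    (hsub : s ⊆ Icc a b) : Integrable (s.indicator fun p => ∏ i, q (p.1 i)) := by
  rw [integrable_indicator_iff hs.measurableSet]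
  refine IntegrableOn.mono_set (ContinuousOn.integrableOn_compact isCompact_Icc ?_) hsub
  exact (continuous_finsetProd _ fun i _ => by fun_prop).continuousOn

/-- The integral of `∏ q(x_i)` over a slice. -/
def RsliceIntegral (q : ℝ → ℝ) (k : ℕ) (y α : ℝ) : ℝ :=
  ∫ p in Rslice k y α, ∏ i, q (p.1 i)

lemma integral_Rregion {q : ℝ → ℝ} (hq : Continuous q) (k : ℕ) (α : ℝ) :
    ∫ p in Rregion k α, ∏ i, q (p.1 i) = ∫ y, q y * RsliceIntegral q k y α := by
  rw [← integral_indicator (isClosed_Rregion k α).measurableSet, integral_finCons_fst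
    (integrable_indicator_prod hq (isClosed_Rregion k α) (Rregion_subset_Icc k α))]
  congr 1
  ext y
  rw [RsliceIntegral, ← integral_indicator (isClosed_Rslice k y α).measurableSet,
    ← integral_const_mul]
  congr 1
  ext w
  by_cases h : w ∈ Rslice k y α
  · rw [indicator_of_mem h, indicator_of_mem (show (Fin.cons y w.1, w.2) ∈ Rregion k α from h),
      Fin.prod_univ_succ]
    simp
  · rw [indicator_of_notMem h, mul_zero,
      indicator_of_notMem (show (Fin.cons y w.1, w.2) ∉ Rregion k α from h)]

lemma integral_indicator_Icc {f : ℝ → ℝ} {a b : ℝ} (hab : a ≤ b) :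
    ∫ x, (Icc a b).indicator f x = ∫ x in a..b, f x := by
  rw [integral_indicator measurableSet_Icc, integral_Icc_eq_integral_Ioc,
    intervalIntegral.integral_of_le hab]

lemma RsliceIntegral_zero {q : ℝ → ℝ} (hq : Continuous q) (y α : ℝ) :
    RsliceIntegral q 0 y α = if 0 ≤ y ∧ y ≤ α then ∫ x in (α - y)..α, q x else 0 := by
  have hmem : ∀ x : ℝ, ((Fin.cons x default, default) : (Fin 1 → ℝ) × (Fin 0 → ℝ)) ∈ Rslice 0 y α ↔
      (0 ≤ y ∧ y ≤ α) ∧ x ∈ Icc (α - y) α := by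
    intro x
    refine mem_Rregion_zero.trans ?_
    change (0 ≤ y ∧ 0 ≤ x) ∧ y ≤ α ∧ x ≤ α ∧ α ≤ y + x ↔ (0 ≤ y ∧ y ≤ α) ∧ α - y ≤ x ∧ x ≤ α
    constructor
    · rintro ⟨⟨h1, h2⟩, h3, h4, h5⟩
      exact ⟨⟨h1, h3⟩, by linarith, h4⟩
    · rintro ⟨⟨h1, h3⟩, h2, h4⟩
      exact ⟨⟨h1, by linarith⟩, h3, h4, by linarith⟩
  rw [RsliceIntegral, ← integral_indicator (isClosed_Rslice 0 y α).measurableSet,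
    integral_finCons_fst (integrable_indicator_prod hq (isClosed_Rslice 0 y α)
      (Rslice_subset_Icc 0 y α))]
  have hvol : (volume : Measure ((Fin 0 → ℝ) × (Fin 0 → ℝ))).real univ = 1 := by
    rw [measureReal_def, ← univ_prod_univ, Measure.volume_eq_prod, Measure.prod_prod]
    simp [volume_pi]
  have hpoint : ∀ f : (Fin 0 → ℝ) × (Fin 0 → ℝ) → ℝ, ∫ w, f w = f (default, default) := by
    intro f
    rw [show f = fun _ => f (default, default) from
      funext fun w => congrArg f (Subsingleton.elim _ _), integral_const, hvol, one_smul]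
  simp only [hpoint]
  split_ifs with h
  · rw [← integral_indicator_Icc (by linarith)]
    congr 1
    ext x
    by_cases hx : x ∈ Icc (α - y) α
    · rw [indicator_of_mem hx]
      refine (indicator_of_mem ((hmem x).2 ⟨h, hx⟩) _).trans ?_
      simp
    · rw [indicator_of_notMem hx]
      exact indicator_of_notMem (fun h' => hx ((hmem x).1 h').2) _
  · rw [← integral_zero ℝ ℝ]
    congr 1
    ext x
    exact indicator_of_notMem (fun h' => h ((hmem x).1 h').1) _

/-- Change of variables `x = β + τ`, `l = y + β - τ`. -/
lemma integral_comp_add_sub {G : ℝ × ℝ → ℝ} (hG : Integrable G) (y : ℝ) :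
    ∫ z, G z = 2 * ∫ τ, ∫ β, G (β + τ, y + β - τ) := by
  have hmp : MeasurePreserving (fun z : ℝ × ℝ => (z.1, z.1 + z.2)) :=
    measurePreserving_prod_add (volume : Measure ℝ) volume
  obtain ⟨h1, h2⟩ := hmp.integrable_comp_and_integral_comp hG
  have h3 : ∫ z : ℝ × ℝ, G (z.1, z.1 + z.2) = ∫ m, ∫ x, G (x, x + m) :=
    integral_prod_symm _ h1
  have h4 := Measure.integral_comp_mul_left (fun m => ∫ x, G (x, x + (y - m))) 2
  have h5 := integral_sub_left_eq_self (fun m => ∫ x, G (x, x + m)) volume y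
  rw [← h2, h3, ← h5]
  have h6 : ∀ τ, ∫ β, G (β + τ, y + β - τ) = ∫ x, G (x, x + (y - 2 * τ)) := by
    intro τ
    rw [← integral_add_right_eq_self (fun x => G (x, x + (y - 2 * τ))) τ]
    congr 1
    ext β
    congr 2
    ring
  simp only [h6]
  rw [h4]
  norm_num
  ring

lemma RsliceIntegral_succ {q : ℝ → ℝ} (hq : Continuous q) (k : ℕ) (y α : ℝ) :
    RsliceIntegral q (k + 1) y α = 2 * ∫ τ, ∫ β,
      if 0 ≤ y ∧ |y - (β + τ)| ≤ y + β - τ ∧ y + β - τ ≤ y + (β + τ)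
      then q (β + τ) * RsliceIntegral q k (β + τ) (α - y + τ) else 0 := by
  obtain ⟨h1, h2⟩ := integral_finCons_finCons (integrable_indicator_prod hq
    (isClosed_Rslice (k + 1) y α) (Rslice_subset_Icc (k + 1) y α))
  rw [RsliceIntegral, ← integral_indicator (isClosed_Rslice (k + 1) y α).measurableSet, h2,
    integral_comp_add_sub h1 y]
  congr 3
  ext τ
  congr 1
  ext β
  have hα : α + (β + τ - y - (y + β - τ)) / 2 = α - y + τ := by ring
  split_ifs with h
  · rw [RsliceIntegral, ← integral_indicator (isClosed_Rslice k _ _).measurableSet,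
      ← integral_const_mul]
    congr 1
    ext w
    by_cases hw : w ∈ Rslice k (β + τ) (α - y + τ)
    · rw [indicator_of_mem hw, indicator_of_mem (mem_Rslice_succ.2 ⟨h, by rwa [hα]⟩),
        Fin.prod_univ_succ]
      simp
    · rw [indicator_of_notMem hw, mul_zero, indicator_of_notMem fun h' => hw ?_]
      have := (mem_Rslice_succ.1 h').2
      rwa [hα] at this
  · rw [← integral_zero ((Fin (k + 1) → ℝ) × (Fin k → ℝ)) ℝ]
    congr 1
    ext w
    exact indicator_of_notMem (fun h' => h (mem_Rslice_succ.1 h').1) _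

lemma RsliceIntegral_eq {q : ℝ → ℝ} (hq : Continuous q) (k : ℕ) (y α : ℝ) :
    RsliceIntegral q k y α =
      if 0 ≤ y ∧ y ≤ α then 2 ^ k * ∫ σ in (0:ℝ)..y, zig q k σ (α - y) 0 else 0 := by
  induction k generalizing y α with
  | zero =>
    rw [RsliceIntegral_zero hq]
    split_ifs
    · simp [zig]
    · rfl
  | succ k ih =>
    rw [RsliceIntegral_succ hq]
    have hind : ∀ τ β, (if 0 ≤ y ∧ |y - (β + τ)| ≤ y + β - τ ∧ y + β - τ ≤ y + (β + τ)
        then q (β + τ) * RsliceIntegral q k (β + τ) (α - y + τ) else 0)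
        = (Icc 0 y).indicator (fun τ => (Icc 0 (α - y)).indicator (fun β =>
          2 ^ k * (q (0 + τ + β) * ∫ σ in (0:ℝ)..(τ + β), zig q k σ (α - y - β) 0)) β) τ := by
      intro τ β
      simp only [indicator_apply, mem_Icc, ih, abs_le]
      by_cases h : (0 ≤ τ ∧ τ ≤ y) ∧ 0 ≤ β ∧ β ≤ α - y
      · obtain ⟨⟨h1, h2⟩, h3, h4⟩ := h
        rw [if_pos ⟨by linarith, ⟨by linarith, by linarith⟩, by linarith⟩,
          if_pos ⟨by linarith, by linarith⟩, if_pos ⟨h1, h2⟩, if_pos ⟨h3, h4⟩,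
          show α - y + τ - (β + τ) = α - y - β by ring, add_comm β τ, zero_add]
        ring
      · trans 0
        · split_ifs with h1 h2
          · exact absurd ⟨⟨by linarith [h1.2.2], by linarith [h1.2.1.2]⟩,
              by linarith [h1.2.1.1], by linarith [h2.2]⟩ h
          · exact mul_zero _
          · rfl
        · split_ifs with h1 h2
          · exact absurd ⟨h1, h2⟩ h
          · rfl
          · rfl
    simp only [hind]
    split_ifs with h
    · have hinner : ∀ τ, (∫ β, (Icc 0 y).indicator (fun τ => (Icc 0 (α - y)).indicator (fun β =>
          2 ^ k * (q (0 + τ + β) * ∫ σ in (0:ℝ)..(τ + β), zig q k σ (α - y - β) 0)) β) τ)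
          = (Icc 0 y).indicator (fun τ => 2 ^ k * zig q (k + 1) τ (α - y) 0) τ := by
        intro τ
        by_cases hτ : τ ∈ Icc 0 y
        · simp only [indicator_of_mem hτ]
          rw [integral_indicator_Icc (by linarith), intervalIntegral.integral_const_mul, zig]
        · simp only [indicator_of_notMem hτ, integral_zero]
      simp only [hinner]
      rw [integral_indicator_Icc h.1, intervalIntegral.integral_const_mul]
      ring
    · have hzero : ∀ τ β, (Icc 0 y).indicator (fun τ => (Icc 0 (α - y)).indicator (fun β =>
          2 ^ k * (q (0 + τ + β) * ∫ σ in (0:ℝ)..(τ + β), zig q k σ (α - y - β) 0)) β) τ = 0 := by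
        intro τ β
        rw [indicator_apply_eq_zero]
        intro hτ
        rw [indicator_apply_eq_zero]
        intro hβ
        exact absurd ⟨hτ.1.trans hτ.2, by linarith [hβ.1.trans hβ.2]⟩ h
      simp only [hzero, integral_zero, mul_zero]

lemma An_eq_zig {q : ℝ → ℝ} (hq : Continuous q) (k : ℕ) {α : ℝ} (hα : 0 ≤ α) :
    An q (k + 2) α = (-1) ^ (k + 1) * zig q (k + 1) 0 α 0 := by
  have hind : ∀ y, q y * RsliceIntegral q k y α = (Icc 0 α).indicator (fun y =>
      2 ^ k * (q (0 + 0 + y) * ∫ σ in (0:ℝ)..(0 + y), zig q k σ (α - y) 0)) y := by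
    intro y
    rw [RsliceIntegral_eq hq, indicator_apply]
    simp only [mem_Icc, zero_add]
    split_ifs <;> ring
  have h : An q (k + 2) α
      = ((-1) ^ (k + 1) / 2 ^ k) * ∫ p in Rregion k α, ∏ i, q (p.1 i) := rfl
  rw [h, integral_Rregion hq]
  simp only [hind]
  rw [integral_indicator_Icc hα, intervalIntegral.integral_const_mul, zig]
  field_simp

lemma zig_comp_add_left (q : ℝ → ℝ) (n : ℕ) (τ α x : ℝ) :
    zig (fun y => q (x + y)) n τ α 0 = zig q n τ α x := by
  induction n generalizing τ α with
  | zero => simp [zig, add_assoc]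
  | succ n ih => simp [zig, ih, add_assoc]

/-- A `C¹` function on `[0,∞)` is the restriction of a `C¹` function on the line. -/
lemma exists_hasDerivAt_extension {q : ℝ → ℝ} (hq : ContDiffOn ℝ 1 q (Ici 0)) :
    ∃ g g' : ℝ → ℝ, Continuous g' ∧ (∀ y, HasDerivAt g (g' y) y) ∧ EqOn q g (Ici 0) := by
  have hc : ContinuousOn (derivWithin q (Ici 0)) (Ici 0) :=
    hq.continuousOn_derivWithin (uniqueDiffOn_Ici 0) le_rfl
  have hp : Continuous fun s => derivWithin q (Ici 0) (max s 0) :=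
    hc.comp_continuous (by fun_prop) fun s => le_max_right s 0
  refine ⟨fun y => q 0 + ∫ s in (0:ℝ)..y, derivWithin q (Ici 0) (max s 0), _, hp,
    fun y => (hasDerivAt_primitive hp y).const_add _, fun y hy => ?_⟩
  have hy0 : (0:ℝ) ≤ y := hy
  have h := intervalIntegral.integral_eq_sub_of_hasDerivAt_of_le (f := q)
    (f' := fun s => derivWithin q (Ici 0) (max s 0)) hy0
    (hq.continuousOn.mono Icc_subset_Ici_self) (fun s hs => ?_) (hp.intervalIntegrable _ _)
  · simp [h]
  · rw [max_eq_left hs.1.le]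
    exact ((hq.differentiableOn one_ne_zero s hs.1.le).hasDerivWithinAt).hasDerivAt
      (Ici_mem_nhds hs.1)

lemma An_congr {q g : ℝ → ℝ} (h : EqOn q g (Ici 0)) (n : ℕ) (α : ℝ) : An q n α = An g n α := by
  unfold An
  congr 1
  refine setIntegral_congr_fun (isClosed_Rregion _ _).measurableSet fun p hp => ?_
  exact Finset.prod_congr rfl fun i _ => h (hp.1 i)

/-- The `A`-function of a translated potential is the alternating sum of zigzag integrals. -/
lemma Axfun_eq_zigSum {q g : ℝ → ℝ} (hg : Continuous g) (h : EqOn q g (Ici 0)) {α x : ℝ}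
    (hα : 0 ≤ α) (hx : 0 ≤ x) : Axfun q α x = zigSum g α x := by
  obtain ⟨u, hu, hb⟩ := exists_summable_zig_bound hg hg α |x| hα
  have hs : Summable fun n => (-1) ^ n * zig g n 0 α x := by
    refine Summable.of_norm_bounded hu fun n => ?_
    simpa [abs_mul] using (hb n α x hα le_rfl le_rfl).1
  have htrans : EqOn (fun y => q (x + y)) (fun y => g (x + y)) (Ici 0) :=
    fun y hy => h (add_nonneg hx hy)
  rw [zigSum, hs.tsum_eq_zero_add, Axfun, Afun]
  congr 1
  · simpa [zig] using htrans hα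
  · congr 1
    ext k
    rw [An_congr htrans, An_eq_zig (by fun_prop) k hα, zig_comp_add_left]

/-- Theorem 6.1:  if `q ∈ L¹(0,∞)` is `C¹` on `[0,∞)`, then `A(α,x)` is jointly `C¹` on
`{α > 0, x ≥ 0}` and obeys `∂A/∂x = ∂A/∂α + ∫₀^α A(β,x)A(α-β,x) dβ` there (the `x`-derivative
being taken within `[0,∞)`). -/
theorem theorem6_1 (q : ℝ → ℝ) (hq : IntegrableOn q (Ioi 0))
    (hq1 : ContDiffOn ℝ 1 q (Ici 0)) :
    ContDiffOn ℝ 1 (fun p : ℝ × ℝ => Axfun q p.1 p.2) {p : ℝ × ℝ | 0 < p.1 ∧ 0 ≤ p.2} ∧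
    ∀ α x : ℝ, 0 < α → 0 ≤ x →
      derivWithin (fun t => Axfun q α t) (Ici 0) x =
        deriv (fun s => Axfun q s x) α +
          ∫ β in Ioo (0:ℝ) α, Axfun q β x * Axfun q (α - β) x := by
  obtain ⟨g, g', hg', hd, hqg⟩ := exists_hasDerivAt_extension hq1
  have hg : Continuous g := continuous_iff_continuousAt.2 fun y => (hd y).continuousAt
  refine ⟨?_, fun α x hα hx => ?_⟩
  · refine ContDiffOn.congr (f := fun p : ℝ × ℝ => zigSum g p.1 p.2) (fun p hp => ?_)
      fun p hp => Axfun_eq_zigSum hg hqg hp.1.le hp.2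
    exact (contDiffAt_zigSum hg' hd p hp.1).contDiffWithinAt
  · have hdiff : DifferentiableAt ℝ (fun t => zigSum g α t) x :=
      ((contDiffAt_zigSum hg' hd (α, x) hα).differentiableAt one_ne_zero).comp x
        (f := fun t : ℝ => (α, t)) (by fun_prop)
    have hbase : derivWithin (fun t => Axfun q α t) (Ici 0) x =
        deriv (fun t => zigSum g α t) x := by
      rw [derivWithin_congr (s := Ici (0:ℝ)) (f := fun t => zigSum g α t)
        (fun t ht => Axfun_eq_zigSum hg hqg hα.le ht) (Axfun_eq_zigSum hg hqg hα.le hx)]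
      exact hdiff.derivWithin (uniqueDiffOn_Ici 0 x hx)
    have hclimb : deriv (fun s => Axfun q s x) α = deriv (fun s => zigSum g s x) α := by
      refine Filter.EventuallyEq.deriv_eq ?_
      filter_upwards [Ioi_mem_nhds hα] with s hs
      exact Axfun_eq_zigSum hg hqg (le_of_lt hs) hx
    rw [hbase, hclimb, deriv_zigSum hg' hd α x hα, intervalIntegral.integral_of_le hα.le,
      integral_Ioc_eq_integral_Ioo]
    congr 1
    refine setIntegral_congr_fun measurableSet_Ioo fun β hβ => ?_
    simp only [Axfun_eq_zigSum hg hqg hβ.1.le hx,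
      Axfun_eq_zigSum hg hqg (sub_nonneg.2 hβ.2.le) hx]

end
end

section
/- Let a > 0 and let C₁, C₂ be continuous real-valued functions on the triangle T = {(γ,x) ∈ ℝ² : 0 ≤ x ≤ γ ≤ a} such that, for i = 1,2 and all 0 ≤ x₁ ≤ x₂ ≤ γ ≤ a, C_i(γ, x₂) = C_i(γ, x₁) + ∫_{x₁}^{x₂} (∫_y^γ C_i(λ, y) C_i(γ − λ + y, y) dλ) dy. If C₁(γ, 0) = C₂(γ, 0) for all γ ∈ [0,a], then C₁ = C₂ on T. -/
open MeasureTheory Set Filter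
open scoped ENNReal

noncomputable section

/-- A continuous function on the triangle `0 ≤ x ≤ γ ≤ a` extends continuously to the plane. -/
theorem exists_continuous_extension_triangle {a : ℝ} (ha : 0 ≤ a) {C : ℝ → ℝ → ℝ}
    (hc : ContinuousOn (fun p : ℝ × ℝ => C p.1 p.2)
      {p : ℝ × ℝ | 0 ≤ p.2 ∧ p.2 ≤ p.1 ∧ p.1 ≤ a}) :
    ∃ G : ℝ → ℝ → ℝ, Continuous (fun p : ℝ × ℝ => G p.1 p.2) ∧
      ∀ γ x, 0 ≤ x → x ≤ γ → γ ≤ a → G γ x = C γ x := by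
  refine ⟨fun γ x => C (max (max 0 (min x a)) (min γ a)) (max 0 (min x a)), ?_, ?_⟩
  · refine hc.comp_continuous
      (f := fun p : ℝ × ℝ => (max (max 0 (min p.2 a)) (min p.1 a), max 0 (min p.2 a)))
      (by fun_prop) fun p => ?_
    exact ⟨le_max_left _ _, le_max_left _ _,
      max_le (max_le ha (min_le_right _ _)) (min_le_right _ _)⟩
  · intro γ x hx hxγ hγ
    simp only [min_eq_left hγ, min_eq_left (hxγ.trans hγ), max_eq_right hx, max_eq_right hxγ]

theorem continuous_integral_mul_reflect {G : ℝ → ℝ → ℝ}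
    (hG : Continuous (fun p : ℝ × ℝ => G p.1 p.2)) (γ : ℝ) :
    Continuous fun y => ∫ l in y..γ, G l y * G (γ - l + y) y := by
  have h : Continuous (Function.uncurry fun y l : ℝ => G l y * G (γ - l + y) y) :=
    (hG.comp (f := fun p : ℝ × ℝ => (p.2, p.1)) (by fun_prop)).mul
      (hG.comp (f := fun p : ℝ × ℝ => (γ - p.2 + p.1, p.1)) (by fun_prop))
  simp_rw [fun y => intervalIntegral.integral_symm (μ := volume)
    (f := fun l => G l y * G (γ - l + y) y) γ y]
  exact (intervalIntegral.continuous_parametric_intervalIntegral_of_continuous h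
    continuous_id).neg

/-- The Lipschitz estimate for the quadratic term of the `A`-equation. -/
theorem abs_integral_mul_reflect_sub_le {G₁ G₂ : ℝ → ℝ → ℝ}
    (h₁ : Continuous (fun p : ℝ × ℝ => G₁ p.1 p.2))
    (h₂ : Continuous (fun p : ℝ × ℝ => G₂ p.1 p.2)) {y γ M B : ℝ} (hyγ : y ≤ γ)
    (hM₁ : ∀ l ∈ Icc y γ, |G₁ l y| ≤ M) (hM₂ : ∀ l ∈ Icc y γ, |G₂ l y| ≤ M)
    (hB : ∀ l ∈ Icc y γ, |G₁ l y - G₂ l y| ≤ B) :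
    |(∫ l in y..γ, G₁ l y * G₁ (γ - l + y) y) - ∫ l in y..γ, G₂ l y * G₂ (γ - l + y) y|
      ≤ 2 * M * B * (γ - y) := by
  have hint : ∀ G : ℝ → ℝ → ℝ, Continuous (fun p : ℝ × ℝ => G p.1 p.2) →
      IntervalIntegrable (fun l => G l y * G (γ - l + y) y) volume y γ := fun G hG =>
    ((hG.comp (f := fun l : ℝ => (l, y)) (by fun_prop)).mul
      (hG.comp (f := fun l : ℝ => (γ - l + y, y)) (by fun_prop))).intervalIntegrable _ _
  rw [← intervalIntegral.integral_sub (hint G₁ h₁) (hint G₂ h₂), ← Real.norm_eq_abs]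
  refine (intervalIntegral.norm_integral_le_of_norm_le_const (C := 2 * M * B)
    fun l hl => ?_).trans_eq (by rw [abs_of_nonneg (sub_nonneg.2 hyγ)])
  rw [uIoc_of_le hyγ] at hl
  have hl' : l ∈ Icc y γ := ⟨hl.1.le, hl.2⟩
  have hr : γ - l + y ∈ Icc y γ := ⟨by linarith [hl.2], by linarith [hl.1]⟩
  have hM0 : 0 ≤ M := (abs_nonneg _).trans (hM₁ l hl')
  calc ‖G₁ l y * G₁ (γ - l + y) y - G₂ l y * G₂ (γ - l + y) y‖
      = |(G₁ l y - G₂ l y) * G₁ (γ - l + y) y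
          + G₂ l y * (G₁ (γ - l + y) y - G₂ (γ - l + y) y)| := by
        rw [Real.norm_eq_abs]; ring_nf
    _ ≤ |G₁ l y - G₂ l y| * |G₁ (γ - l + y) y|
          + |G₂ l y| * |G₁ (γ - l + y) y - G₂ (γ - l + y) y| := by
        rw [← abs_mul, ← abs_mul]
        exact abs_add_le _ _
    _ ≤ B * M + M * B := by
        have hB0 : 0 ≤ B := (abs_nonneg _).trans (hB l hl')
        gcongr
        · exact hB l hl'
        · exact hM₁ _ hr
        · exact hM₂ l hl'
        · exact hB _ hr
    _ = 2 * M * B := by ring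

/-- Uniqueness for the integral form of the `A`-equation, for solutions defined and continuous
on the whole plane. -/
theorem A_equation_uniqueness_of_continuous {a : ℝ} (ha : 0 ≤ a) {G₁ G₂ : ℝ → ℝ → ℝ}
    (hc₁ : Continuous (fun p : ℝ × ℝ => G₁ p.1 p.2))
    (hc₂ : Continuous (fun p : ℝ × ℝ => G₂ p.1 p.2))
    (heq₁ : ∀ γ x : ℝ, 0 ≤ x → x ≤ γ → γ ≤ a →
      G₁ γ x = G₁ γ 0 + ∫ y in (0 : ℝ)..x, ∫ l in y..γ, G₁ l y * G₁ (γ - l + y) y)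
    (heq₂ : ∀ γ x : ℝ, 0 ≤ x → x ≤ γ → γ ≤ a →
      G₂ γ x = G₂ γ 0 + ∫ y in (0 : ℝ)..x, ∫ l in y..γ, G₂ l y * G₂ (γ - l + y) y)
    (h0 : ∀ γ ∈ Icc (0:ℝ) a, G₁ γ 0 = G₂ γ 0) {γ x : ℝ}
    (hx : 0 ≤ x) (hxγ : x ≤ γ) (hγ : γ ≤ a) : G₁ γ x = G₂ γ x := by
  have hK : IsCompact (Icc (0 : ℝ) a ×ˢ Icc (0 : ℝ) a) := isCompact_Icc.prod isCompact_Icc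
  obtain ⟨M₁, hM₁⟩ := hK.exists_bound_of_continuousOn hc₁.continuousOn
  obtain ⟨M₂, hM₂⟩ := hK.exists_bound_of_continuousOn hc₂.continuousOn
  set M := max M₁ M₂
  have hb₁ : ∀ γ x, 0 ≤ x → x ≤ γ → γ ≤ a → |G₁ γ x| ≤ M := fun γ x h h' h'' =>
    (hM₁ (γ, x) ⟨⟨h.trans h', h''⟩, h, h'.trans h''⟩).trans (le_max_left _ _)
  have hb₂ : ∀ γ x, 0 ≤ x → x ≤ γ → γ ≤ a → |G₂ γ x| ≤ M := fun γ x h h' h'' =>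
    (hM₂ (γ, x) ⟨⟨h.trans h', h''⟩, h, h'.trans h''⟩).trans (le_max_right _ _)
  have hM0 : 0 ≤ M := (abs_nonneg _).trans (hb₁ 0 0 le_rfl le_rfl ha)
  have key : ∀ n : ℕ, ∀ γ x, 0 ≤ x → x ≤ γ → γ ≤ a →
      |G₁ γ x - G₂ γ x| ≤ 2 * M * ((2 * M * a * x) ^ n / n.factorial) := by
    intro n
    induction n with
    | zero =>
      intro γ x hx hxγ hγ
      have := abs_sub (G₁ γ x) (G₂ γ x)
      simp only [pow_zero, Nat.factorial_zero, Nat.cast_one, div_one, mul_one]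
      linarith [hb₁ γ x hx hxγ hγ, hb₂ γ x hx hxγ hγ]
    | succ n ih =>
      intro γ x hx hxγ hγ
      rw [heq₁ γ x hx hxγ hγ, heq₂ γ x hx hxγ hγ, h0 γ ⟨hx.trans hxγ, hγ⟩, add_sub_add_left_eq_sub,
        ← intervalIntegral.integral_sub
          ((continuous_integral_mul_reflect hc₁ γ).intervalIntegrable _ _)
          ((continuous_integral_mul_reflect hc₂ γ).intervalIntegrable _ _), ← Real.norm_eq_abs]
      refine (intervalIntegral.norm_integral_le_of_norm_le hx
        (g := fun y => 2 * M * ((2 * M * a) ^ (n + 1) / n.factorial) * y ^ n)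
        (ae_of_all _ fun y hy => ?_)
        (Continuous.intervalIntegrable (by fun_prop) _ _)).trans_eq ?_
      · have hyγ : y ≤ γ := hy.2.trans hxγ
        have hy0 : 0 ≤ y := hy.1.le
        refine (abs_integral_mul_reflect_sub_le hc₁ hc₂ hyγ
          (fun l hl => hb₁ l y hy0 hl.1 (hl.2.trans hγ))
          (fun l hl => hb₂ l y hy0 hl.1 (hl.2.trans hγ))
          (fun l hl => ih l y hy0 hl.1 (hl.2.trans hγ))).trans ?_
        calc _ ≤ 2 * M * (2 * M * ((2 * M * a * y) ^ n / n.factorial)) * a := by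
              gcongr; linarith
          _ = _ := by rw [mul_pow (2 * M * a) y]; ring
      · rw [intervalIntegral.integral_const_mul, integral_pow, Nat.factorial_succ, mul_pow _ x]
        push_cast
        field_simp
        simp
  have hlim := (FloorSemiring.tendsto_pow_div_factorial_atTop (2 * M * a * x)).const_mul (2 * M)
  rw [mul_zero] at hlim
  exact sub_eq_zero.1 (abs_nonpos_iff.1
    (ge_of_tendsto' hlim fun n => key n γ x hx hxγ hγ))

/-- Uniqueness for the integral form of the `A`-equation on the triangle
`T = {0 ≤ x ≤ γ ≤ a}`:  two continuous solutions which agree at `x = 0` agree on all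
of `T`. -/
theorem A_equation_uniqueness (a : ℝ) (ha : 0 < a) (C₁ C₂ : ℝ → ℝ → ℝ)
    (hc₁ : ContinuousOn (fun p : ℝ × ℝ => C₁ p.1 p.2)
      {p : ℝ × ℝ | 0 ≤ p.2 ∧ p.2 ≤ p.1 ∧ p.1 ≤ a})
    (hc₂ : ContinuousOn (fun p : ℝ × ℝ => C₂ p.1 p.2)
      {p : ℝ × ℝ | 0 ≤ p.2 ∧ p.2 ≤ p.1 ∧ p.1 ≤ a})
    (heq₁ : ∀ γ x₁ x₂ : ℝ, 0 ≤ x₁ → x₁ ≤ x₂ → x₂ ≤ γ → γ ≤ a →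
      C₁ γ x₂ = C₁ γ x₁ + ∫ y in x₁..x₂, ∫ l in y..γ, C₁ l y * C₁ (γ - l + y) y)
    (heq₂ : ∀ γ x₁ x₂ : ℝ, 0 ≤ x₁ → x₁ ≤ x₂ → x₂ ≤ γ → γ ≤ a →
      C₂ γ x₂ = C₂ γ x₁ + ∫ y in x₁..x₂, ∫ l in y..γ, C₂ l y * C₂ (γ - l + y) y)
    (h0 : ∀ γ ∈ Icc (0:ℝ) a, C₁ γ 0 = C₂ γ 0) :
    ∀ γ x : ℝ, 0 ≤ x → x ≤ γ → γ ≤ a → C₁ γ x = C₂ γ x := by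
  have transfer : ∀ C G : ℝ → ℝ → ℝ,
      (∀ γ x, 0 ≤ x → x ≤ γ → γ ≤ a → G γ x = C γ x) →
      (∀ γ x₁ x₂ : ℝ, 0 ≤ x₁ → x₁ ≤ x₂ → x₂ ≤ γ → γ ≤ a →
        C γ x₂ = C γ x₁ + ∫ y in x₁..x₂, ∫ l in y..γ, C l y * C (γ - l + y) y) →
      ∀ γ x : ℝ, 0 ≤ x → x ≤ γ → γ ≤ a →
        G γ x = G γ 0 + ∫ y in (0 : ℝ)..x, ∫ l in y..γ, G l y * G (γ - l + y) y := by
    intro C G hG heq γ x hx hxγ hγ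
    rw [hG γ x hx hxγ hγ, hG γ 0 le_rfl (hx.trans hxγ) hγ, heq γ 0 x le_rfl hx hxγ hγ]
    congr 1
    refine intervalIntegral.integral_congr fun y hy =>
      intervalIntegral.integral_congr fun l hl => ?_
    rw [uIcc_of_le hx] at hy
    rw [uIcc_of_le (hy.2.trans hxγ)] at hl
    rw [hG l y hy.1 hl.1 (hl.2.trans hγ),
      hG (γ - l + y) y hy.1 (by linarith [hl.2]) (by linarith [hl.1])]
  obtain ⟨G₁, hG₁, hGC₁⟩ := exists_continuous_extension_triangle ha.le hc₁
  obtain ⟨G₂, hG₂, hGC₂⟩ := exists_continuous_extension_triangle ha.le hc₂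
  intro γ x hx hxγ hγ
  rw [← hGC₁ γ x hx hxγ hγ, ← hGC₂ γ x hx hxγ hγ]
  refine A_equation_uniqueness_of_continuous ha.le hG₁ hG₂ (transfer C₁ G₁ hGC₁ heq₁)
    (transfer C₂ G₂ hGC₂ heq₂) (fun γ hγ => ?_) hx hxγ hγ
  rw [hGC₁ γ 0 le_rfl hγ.1 hγ.2, hGC₂ γ 0 le_rfl hγ.1 hγ.2, h0 γ hγ]

end
end
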